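/- arXiv:1708.01916 — 6 statements merged into one kernel-verified Lean document; each statement's English description precedes it below -/
import Mathlib

section
/- Let n ≥ 4 and 2 ≤ s ≤ n−2, and let G be a cograph of order n whose vertex set can be partitioned into sets V_1 and V_2 of sizes s and n−s respectively such that every vertex of V_1 is adjacent to every vertex of V_2 (i.e., G is the join of the two cographs induced on V_1 and V_2). Then M*_G ≤ M*_{K_{s,n−s}}, with equality if and only if G is isomorphic to K_{s,n−s}. -/
open SimpleGraph Finset

/-- The collection of nonempty vertex subsets inducing a connected subgraph. -/
noncomputable def connSets {V : Type*} [Fintype V] (G : SimpleGraph V) : Finset (Finset V) :=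
  (Set.toFinite {S : Finset V | S.Nonempty ∧ (G.induce (S : Set V)).Connected}).toFinset

/-- The global mean `M_G`: the average cardinality of the nonempty vertex subsets
inducing a connected subgraph. -/
noncomputable def globalMean {V : Type*} [Fintype V] (G : SimpleGraph V) : ℝ :=
  (∑ S ∈ connSets G, (S.card : ℝ)) / ((connSets G).card : ℝ)

/-- The collection of vertex subsets containing `v` and inducing a connected subgraph. -/
noncomputable def localSets {V : Type*} [Fintype V] (G : SimpleGraph V) (v : V) :
    Finset (Finset V) :=
  (Set.toFinite {S : Finset V | v ∈ S ∧ (G.induce (S : Set V)).Connected}).toFinset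

/-- The local mean `M_{G,v}`: the average cardinality of the vertex subsets containing `v`
and inducing a connected subgraph. -/
noncomputable def localMean {V : Type*} [Fintype V] (G : SimpleGraph V) (v : V) : ℝ :=
  (∑ S ∈ localSets G v, (S.card : ℝ)) / ((localSets G v).card : ℝ)

/-- The collection of vertex subsets of size at least `2` inducing a connected subgraph. -/
noncomputable def mstarSets {V : Type*} [Fintype V] (G : SimpleGraph V) : Finset (Finset V) :=
  (Set.toFinite {S : Finset V | 2 ≤ S.card ∧ (G.induce (S : Set V)).Connected}).toFinset

/-- The `M*` mean `M*_G`: the average cardinality of the vertex subsets of size at least `2`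
inducing a connected subgraph (it equals `0` if there are no such subsets, by the
`0/0 = 0` convention of real division). -/
noncomputable def mstarMean {V : Type*} [Fintype V] (G : SimpleGraph V) : ℝ :=
  (∑ S ∈ mstarSets G, (S.card : ℝ)) / ((mstarSets G).card : ℝ)

/-- A cograph is a graph with no induced subgraph isomorphic to the path on 4 vertices. -/
def IsCograph {V : Type*} (G : SimpleGraph V) : Prop :=
  IsEmpty (SimpleGraph.pathGraph 4 ↪g G)

/-- The `n`-skillet `S_n = K_1 + (K_1 ∪ K_{n-2})`: vertex `0` is adjacent to all other
vertices, vertex `1` is adjacent only to vertex `0`, and the vertices `2, …, n-1` form a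
clique, each also adjacent to vertex `0`. -/
def skillet (n : ℕ) : SimpleGraph (Fin n) :=
  SimpleGraph.fromRel (fun i j => (i : ℕ) = 0 ∨ (2 ≤ (i : ℕ) ∧ 2 ≤ (j : ℕ)))

def NoP4 {V : Type*} (G : SimpleGraph V) : Prop :=
  ∀ a b c d, G.Adj a b → G.Adj b c → G.Adj c d → ¬ G.Adj a c → ¬ G.Adj b d → ¬ G.Adj a d → False

lemma noP4_of_cograph {V : Type*} (G : SimpleGraph V) (h : IsCograph G) : NoP4 G := by
  intro a b c d hab hbc hcd hac hbd had
  have nac : a ≠ c := by rintro rfl; exact had hcd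
  have nbd : b ≠ d := by rintro rfl; exact had hab
  have nad : a ≠ d := by rintro rfl; exact hac hcd.symm
  have nab := hab.ne
  have nbc := hbc.ne
  have ncd := hcd.ne
  refine h.false ⟨⟨![a, b, c, d], ?_⟩, ?_⟩
  · intro i j hij
    fin_cases i <;> fin_cases j <;> simp_all
  · intro i j
    change G.Adj (![a, b, c, d] i) (![a, b, c, d] j) ↔ _
    fin_cases i <;> fin_cases j <;>
      simp_all [SimpleGraph.pathGraph_adj, G.adj_comm]

lemma noP4_compl {V : Type*} (G : SimpleGraph V) (h : NoP4 G) : NoP4 Gᶜ := by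
  intro a b c d hab hbc hcd hac hbd had
  simp only [SimpleGraph.compl_adj, not_and, not_not] at *
  have nac : a ≠ c := by rintro rfl; exact hcd.2 (had hcd.1)
  have nbd : b ≠ d := by rintro rfl; exact hab.2 (had hab.1)
  have nad : a ≠ d := by rintro rfl; exact hcd.2 (hac nac).symm
  exact h c a d b (hac nac).symm (had nad) (hbd nbd).symm hcd.2 hab.2 (fun e => hbc.2 e.symm)

/-- a split of `S` with no edges across -/
def Split {V : Type*} [DecidableEq V] (G : SimpleGraph V) (S : Finset V) : Prop :=
  ∃ P Q : Finset V, P.Nonempty ∧ Q.Nonempty ∧ Disjoint P Q ∧ P ∪ Q = S ∧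
    ∀ x ∈ P, ∀ y ∈ Q, ¬ G.Adj x y

lemma split_step_aux {V : Type*} [DecidableEq V] (G : SimpleGraph V) (h : NoP4 G)
    (v : V) (P Q : Finset V) (hv : v ∉ P ∪ Q) (hd : Disjoint P Q)
    (hPQ : ∀ x ∈ P, ∀ y ∈ Q, ¬ G.Adj x y)
    (hq : ∃ z ∈ Q, G.Adj v z) (hp : ∃ x ∈ P, ¬ G.Adj v x) :
    Split G (insert v (P ∪ Q)) := by
  classical
  obtain ⟨z, hzQ, hz⟩ := hq
  obtain ⟨x, hxP, hx⟩ := hp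
  refine ⟨P.filter (fun x => ¬ G.Adj v x), insert v (P.filter (fun x => G.Adj v x) ∪ Q),
    ⟨x, by simp [hxP, hx]⟩, ⟨v, by simp⟩, ?_, ?_, ?_⟩
  · rw [Finset.disjoint_left] at hd ⊢
    intro a ha hb
    simp only [Finset.mem_filter, Finset.mem_insert, Finset.mem_union] at ha hb hv
    rcases hb with rfl | hb | hb
    · exact hv (Or.inl ha.1)
    · exact ha.2 hb.2
    · exact hd ha.1 hb
  · ext a
    simp only [Finset.mem_filter, Finset.mem_insert, Finset.mem_union]
    tauto
  · intro a ha b hb hab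
    simp only [Finset.mem_filter, Finset.mem_insert, Finset.mem_union] at ha hb
    rcases hb with rfl | hb | hb
    · exact ha.2 hab.symm
    · exact h z v b a hz.symm hb.2 hab.symm (fun e => hPQ b hb.1 z hzQ e.symm) ha.2
        (fun e => hPQ a ha.1 z hzQ e.symm)
    · exact hPQ a ha.1 b hb hab

lemma split_step {V : Type*} [DecidableEq V] (G : SimpleGraph V) (h : NoP4 G)
    (v : V) (T : Finset V) (hv : v ∉ T) (hT : Split G T) :
    Split G (insert v T) ∨ Split Gᶜ (insert v T) := by
  classical
  obtain ⟨P, Q, hP, hQ, hd, rfl, hPQ⟩ := hT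
  have hvP : v ∉ P := fun e => hv (by simp [e])
  have hvQ : v ∉ Q := fun e => hv (by simp [e])
  by_cases hp : ∃ z ∈ P, G.Adj v z
  · by_cases hq : ∃ z ∈ Q, G.Adj v z
    · by_cases hp' : ∃ x ∈ P, ¬ G.Adj v x
      · exact Or.inl (split_step_aux G h v P Q hv hd hPQ hq hp')
      · by_cases hq' : ∃ x ∈ Q, ¬ G.Adj v x
        · left
          rw [Finset.union_comm]
          exact split_step_aux G h v Q P (by rwa [Finset.union_comm]) hd.symm
            (fun x hx y hy e => hPQ y hy x hx e.symm) hp hq'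
        · right
          push Not at hp' hq'
          refine ⟨{v}, P ∪ Q, by simp, hP.mono (by simp), by simpa using hv, rfl, ?_⟩
          intro x hx y hy e
          rw [Finset.mem_singleton] at hx
          subst hx
          rw [SimpleGraph.compl_adj] at e
          rcases Finset.mem_union.1 hy with hy | hy
          · exact e.2 (hp' y hy)
          · exact e.2 (hq' y hy)
    · left
      push Not at hq
      refine ⟨Q, insert v P, hQ, by simp, ?_, ?_, ?_⟩
      · simp [hvQ, hd.symm]
      · ext a; simp only [Finset.mem_insert, Finset.mem_union]; tauto
      · intro x hx y hy e
        rcases Finset.mem_insert.1 hy with rfl | hy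
        · exact hq x hx e.symm
        · exact hPQ y hy x hx e.symm
  · left
    push Not at hp
    refine ⟨P, insert v Q, hP, by simp, ?_, ?_, ?_⟩
    · simp [hvP, hd]
    · ext a; simp only [Finset.mem_insert, Finset.mem_union]; tauto
    · intro x hx y hy e
      rcases Finset.mem_insert.1 hy with rfl | hy
      · exact hp x hx e.symm
      · exact hPQ x hx y hy e

lemma split_or {V : Type*} [DecidableEq V] (G : SimpleGraph V) (h : NoP4 G)
    (S : Finset V) : 2 ≤ S.card → Split G S ∨ Split Gᶜ S := by
  induction S using Finset.induction_on with
  | empty => simp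
  | insert v T hv ih =>
    intro hc
    rw [Finset.card_insert_of_notMem hv] at hc
    by_cases h2 : 2 ≤ T.card
    · rcases ih h2 with ih | ih
      · exact split_step G h v T hv ih
      · have := split_step Gᶜ (noP4_compl G h) v T hv ih
        rw [compl_compl] at this
        exact this.symm
    · obtain ⟨w, rfl⟩ := Finset.card_eq_one.1 (show T.card = 1 by omega)
      by_cases e : G.Adj v w
      · right
        refine ⟨{v}, {w}, by simp, by simp, by simpa using hv, rfl, ?_⟩
        simp [e]
      · left
        refine ⟨{v}, {w}, by simp, by simp, by simpa using hv, rfl, ?_⟩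
        simp [e]

lemma conn_of_join {V : Type*} (G : SimpleGraph V) (P Q T : Finset V)
    (hj : ∀ x ∈ P, ∀ y ∈ Q, G.Adj x y) (hT : ∀ x ∈ T, x ∈ P ∨ x ∈ Q)
    (hp : ∃ x ∈ T, x ∈ P) (hq : ∃ x ∈ T, x ∈ Q) : (G.induce (T : Set V)).Connected := by
  obtain ⟨x, hxT, hx⟩ := hp
  obtain ⟨y, hyT, hy⟩ := hq
  rw [SimpleGraph.connected_iff_exists_forall_reachable]
  refine ⟨⟨x, hxT⟩, ?_⟩
  have hxy : (G.induce (T : Set V)).Adj ⟨x, hxT⟩ ⟨y, hyT⟩ := by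
    simpa using hj x hx y hy
  rintro ⟨w, hw⟩
  rcases hT w hw with h | h
  · refine hxy.reachable.trans (SimpleGraph.Adj.reachable ?_)
    simpa using (hj w h y hy).symm
  · refine SimpleGraph.Adj.reachable ?_
    simpa using hj x hx w h

lemma sub_of_conn {V : Type*} (G : SimpleGraph V) (P Q T : Finset V)
    (hj : ∀ x ∈ P, ∀ y ∈ Q, ¬ G.Adj x y) (hT : ∀ x ∈ T, x ∈ P ∨ x ∈ Q)
    (hc : (G.induce (T : Set V)).Connected) : T ⊆ P ∨ T ⊆ Q := by
  by_cases hq : T ⊆ Q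
  · exact Or.inr hq
  left
  obtain ⟨x, hxT, hxQ⟩ := Finset.not_subset.1 hq
  have hxP : x ∈ P := (hT x hxT).resolve_right hxQ
  intro y hy
  have hr := hc.preconnected ⟨x, hxT⟩ ⟨y, hy⟩
  rw [SimpleGraph.reachable_iff_reflTransGen] at hr
  have key : ∀ z : (T : Set V), Relation.ReflTransGen (G.induce (T : Set V)).Adj ⟨x, hxT⟩ z →
      (z : V) ∈ P := by
    intro z hz
    induction hz with
    | refl => exact hxP
    | @tail b c _ hbc ih =>
      have hbc' : G.Adj b c := by simpa using hbc
      rcases hT c c.2 with h | h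
      · exact h
      · exact absurd hbc' (hj _ ih _ h)
  exact key _ hr

/-- connected sets of size at least two inside `S` -/
noncomputable def CS {V : Type*} [Fintype V] [DecidableEq V] (G : SimpleGraph V) (S : Finset V) :
    Finset (Finset V) := (mstarSets G).filter (fun T => T ⊆ S)

lemma mem_mstar {V : Type*} [Fintype V] (G : SimpleGraph V) (T : Finset V) :
    T ∈ mstarSets G ↔ 2 ≤ T.card ∧ (G.induce (T : Set V)).Connected := by
  simp [mstarSets]

lemma mem_CS {V : Type*} [Fintype V] [DecidableEq V] (G : SimpleGraph V) (S T : Finset V) :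
    T ∈ CS G S ↔ (2 ≤ T.card ∧ (G.induce (T : Set V)).Connected) ∧ T ⊆ S := by
  simp [CS, mem_mstar]

def crossSets {V : Type*} [DecidableEq V] (P Q : Finset V) : Finset (Finset V) :=
  (P ∪ Q).powerset \ (P.powerset ∪ Q.powerset)

lemma mem_cross {V : Type*} [DecidableEq V] (P Q T : Finset V) :
    T ∈ crossSets P Q ↔ T ⊆ P ∪ Q ∧ ¬ T ⊆ P ∧ ¬ T ⊆ Q := by
  simp only [crossSets, Finset.mem_sdiff, Finset.mem_union, Finset.mem_powerset, not_or]

lemma CS_disj {V : Type*} [Fintype V] [DecidableEq V] (G : SimpleGraph V) (P Q : Finset V)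
    (hd : Disjoint P Q) : Disjoint (CS G P) (CS G Q) := by
  rw [Finset.disjoint_left]
  intro T h1 h2
  rw [mem_CS] at h1 h2
  have : T ⊆ ∅ := by
    rw [← Finset.disjoint_iff_inter_eq_empty.1 hd]
    exact Finset.subset_inter h1.2 h2.2
  have h3 := Finset.card_le_card this
  have h4 := h1.1.1
  rw [Finset.card_empty] at h3
  omega

lemma CS_split {V : Type*} [Fintype V] [DecidableEq V] (G : SimpleGraph V) (P Q : Finset V)
    (hd : Disjoint P Q) (hj : ∀ x ∈ P, ∀ y ∈ Q, ¬ G.Adj x y) (g : Finset V → ℝ) :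
    ∑ T ∈ CS G (P ∪ Q), g T = ∑ T ∈ CS G P, g T + ∑ T ∈ CS G Q, g T := by
  rw [← Finset.sum_union (CS_disj G P Q hd)]
  congr 1
  ext T
  simp only [Finset.mem_union, mem_CS]
  constructor
  · rintro ⟨h, hT⟩
    rcases sub_of_conn G P Q T hj (fun x hx => Finset.mem_union.1 (hT hx)) h.2 with h' | h'
    · exact Or.inl ⟨h, h'⟩
    · exact Or.inr ⟨h, h'⟩
  · rintro (h | h)
    · exact ⟨h.1, h.2.trans Finset.subset_union_left⟩
    · exact ⟨h.1, h.2.trans Finset.subset_union_right⟩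

lemma CS_join {V : Type*} [Fintype V] [DecidableEq V] (G : SimpleGraph V) (P Q : Finset V)
    (hd : Disjoint P Q) (hj : ∀ x ∈ P, ∀ y ∈ Q, G.Adj x y) (g : Finset V → ℝ) :
    ∑ T ∈ CS G (P ∪ Q), g T =
      ∑ T ∈ crossSets P Q, g T + (∑ T ∈ CS G P, g T + ∑ T ∈ CS G Q, g T) := by
  have hd2 : Disjoint (crossSets P Q) (CS G P ∪ CS G Q) := by
    rw [Finset.disjoint_left]
    intro T h1 h2
    rw [mem_cross] at h1
    rw [Finset.mem_union, mem_CS, mem_CS] at h2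
    rcases h2 with h | h
    · exact h1.2.1 h.2
    · exact h1.2.2 h.2
  rw [← Finset.sum_union (CS_disj G P Q hd), ← Finset.sum_union hd2]
  congr 1
  ext T
  simp only [Finset.mem_union, mem_CS, mem_cross]
  constructor
  · rintro ⟨h, hT⟩
    by_cases h1 : T ⊆ P
    · exact Or.inr (Or.inl ⟨h, h1⟩)
    by_cases h2 : T ⊆ Q
    · exact Or.inr (Or.inr ⟨h, h2⟩)
    exact Or.inl ⟨hT, h1, h2⟩
  · rintro (⟨h, h1, h2⟩ | h | h)
    · obtain ⟨x, hx, hx'⟩ := Finset.not_subset.1 h1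
      obtain ⟨y, hy, hy'⟩ := Finset.not_subset.1 h2
      have hh : ∀ x ∈ T, x ∈ P ∨ x ∈ Q := fun x hx => Finset.mem_union.1 (h hx)
      have hxQ := (hh x hx).resolve_left hx'
      have hyP := (hh y hy).resolve_right hy'
      refine ⟨⟨?_, conn_of_join G P Q T hj hh ⟨y, hy, hyP⟩ ⟨x, hx, hxQ⟩⟩, h⟩
      exact Finset.one_lt_card.2 ⟨x, hx, y, hy, by rintro rfl; exact hx' hyP⟩
    · exact ⟨h.1, h.2.trans Finset.subset_union_left⟩
    · exact ⟨h.1, h.2.trans Finset.subset_union_right⟩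

lemma pow_sum {V : Type*} [DecidableEq V] (S : Finset V) (a b : ℝ) :
    ∑ T ∈ S.powerset, (2 * a * (T.card : ℝ) + b) = (a * S.card + b) * 2 ^ S.card := by
  induction S using Finset.induction_on generalizing b with
  | empty => simp
  | insert v T hv ih =>
    rw [Finset.sum_powerset_insert hv, ih]
    have : ∑ t ∈ T.powerset, (2 * a * ((insert v t).card : ℝ) + b) =
        ∑ t ∈ T.powerset, (2 * a * (t.card : ℝ) + (b + 2 * a)) := by
      refine Finset.sum_congr rfl (fun t ht => ?_)
      rw [Finset.card_insert_of_notMem (fun h => hv (Finset.mem_powerset.1 ht h))]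
      push_cast; ring
    rw [this, ih, Finset.card_insert_of_notMem hv]
    push_cast; ring

lemma cross_sum {V : Type*} [DecidableEq V] (P Q : Finset V) (hd : Disjoint P Q) (a b : ℝ) :
    ∑ T ∈ crossSets P Q, (2 * a * (T.card : ℝ) + b) =
      (a * (P.card + Q.card) + b) * (2 ^ P.card * 2 ^ Q.card) - (a * P.card + b) * 2 ^ P.card
        - (a * Q.card + b) * 2 ^ Q.card + b := by
  have h1 := Finset.sum_sdiff (f := fun T : Finset V => 2 * a * (T.card : ℝ) + b)
    (show P.powerset ∪ Q.powerset ⊆ (P ∪ Q).powerset from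
      Finset.union_subset (Finset.powerset_mono.2 Finset.subset_union_left)
        (Finset.powerset_mono.2 Finset.subset_union_right))
  have h2 := Finset.sum_union_inter (f := fun T : Finset V => 2 * a * (T.card : ℝ) + b)
    (s₁ := P.powerset) (s₂ := Q.powerset)
  have h3 : P.powerset ∩ Q.powerset = {∅} := by
    ext T
    rw [Finset.mem_inter, Finset.mem_powerset, Finset.mem_powerset, Finset.mem_singleton,
      ← Finset.subset_inter_iff, Finset.disjoint_iff_inter_eq_empty.1 hd, Finset.subset_empty]
  rw [h3] at h2
  simp only [pow_sum, Finset.sum_singleton, Finset.card_empty] at h1 h2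
  rw [Finset.card_union_of_disjoint hd, pow_add] at h1
  unfold crossSets
  push_cast at h1 h2
  linarith

lemma le_two_pow (p : ℕ) : (p : ℝ) + 1 ≤ 2 ^ p := by
  have : p + 1 ≤ 2 ^ p := Nat.lt_two_pow_self
  exact_mod_cast this

lemma key_bound {V : Type*} [Fintype V] [DecidableEq V] (G : SimpleGraph V) (h : NoP4 G)
    (S : Finset V) : ∀ c : ℝ, (S.card : ℝ) + 2 ≤ c →
      ∑ T ∈ CS G S, (2 * 1 * (T.card : ℝ) + -c) ≤ 0 := by
  induction S using Finset.strongInduction with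
  | H S ih =>
    intro c hc
    by_cases h2 : 2 ≤ S.card
    · rcases split_or G h S h2 with ⟨P, Q, hP, hQ, hd, rfl, hj⟩ | ⟨P, Q, hP, hQ, hd, rfl, hj⟩
      all_goals
        have hPc := hP.card_pos
        have hQc := hQ.card_pos
        have hcard := Finset.card_union_of_disjoint hd
        rw [hcard] at hc
        push_cast at hc
        have hPs : P ⊂ P ∪ Q := by
          refine Finset.ssubset_iff_subset_ne.2 ⟨Finset.subset_union_left, fun e => ?_⟩
          rw [← e] at hcard; omega
        have hQs : Q ⊂ P ∪ Q := by
          refine Finset.ssubset_iff_subset_ne.2 ⟨Finset.subset_union_right, fun e => ?_⟩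
          rw [← e] at hcard; omega
        have p0 : (0 : ℝ) ≤ P.card := by positivity
        have q0 : (0 : ℝ) ≤ Q.card := by positivity
        have i1 := ih P hPs c (by linarith)
        have i2 := ih Q hQs c (by linarith)
      · rw [CS_split G P Q hd hj]
        linarith
      · have hj' : ∀ x ∈ P, ∀ y ∈ Q, G.Adj x y := by
          intro x hx y hy
          have := hj x hx y hy
          rw [SimpleGraph.compl_adj] at this
          by_contra hn
          exact this ⟨fun e => Finset.disjoint_left.1 hd hx (e ▸ hy), hn⟩
        rw [CS_join G P Q hd hj', cross_sum P Q hd]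
        have e1 := le_two_pow P.card
        have e2 := le_two_pow Q.card
        generalize (2 : ℝ) ^ P.card = x at *
        generalize (2 : ℝ) ^ Q.card = y at *
        generalize (P.card : ℝ) = p at *
        generalize (Q.card : ℝ) = q at *
        have : (p + q - c) * ((x - 1) * (y - 1)) ≤ (-2) * ((x - 1) * (y - 1)) :=
          mul_le_mul_of_nonneg_right (by linarith)
            (mul_nonneg (by linarith) (by linarith))
        have t1 : p * (y - 1) ≤ (x - 1) * (y - 1) :=
          mul_le_mul_of_nonneg_right (by linarith) (by linarith)
        have t2 : q * (x - 1) ≤ (y - 1) * (x - 1) :=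
          mul_le_mul_of_nonneg_right (by linarith) (by linarith)
        nlinarith
    · have : CS G S = ∅ := by
        rw [Finset.eq_empty_iff_forall_notMem]
        intro T hT
        rw [mem_CS] at hT
        have := Finset.card_le_card hT.2
        omega
      simp [this]

lemma mean_formula {V : Type*} [Fintype V] [DecidableEq V] (G : SimpleGraph V)
    (A : Finset V) (s t : ℕ) (hA : A.card = s) (hB : Aᶜ.card = t)
    (hj : ∀ u ∈ A, ∀ w ∉ A, G.Adj u w) (a b : ℝ) :
    ∑ T ∈ mstarSets G, (2 * a * (T.card : ℝ) + b) =
      ((a * (s + t) + b) * (2 ^ s * 2 ^ t) - (a * s + b) * 2 ^ s - (a * t + b) * 2 ^ t + b)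
      + (∑ T ∈ CS G A, (2 * a * (T.card : ℝ) + b) + ∑ T ∈ CS G Aᶜ, (2 * a * (T.card : ℝ) + b)) := by
  have hd : Disjoint A Aᶜ := disjoint_compl_right
  have h := CS_join G A Aᶜ hd (fun x hx y hy => hj x hx y (Finset.mem_compl.1 hy))
    (fun T => 2 * a * (T.card : ℝ) + b)
  rw [cross_sum A Aᶜ hd, hA, hB] at h
  rw [← h]
  congr 1
  simp [CS, Finset.union_compl]

lemma CS_empty_of {V : Type*} [Fintype V] [DecidableEq V] (G : SimpleGraph V) (S : Finset V)
    (h : ∀ x ∈ S, ∀ y ∈ S, ¬ G.Adj x y) : CS G S = ∅ := by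
  rw [Finset.eq_empty_iff_forall_notMem]
  intro T hT
  rw [mem_CS] at hT
  obtain ⟨⟨hc, hconn⟩, hs⟩ := hT
  obtain ⟨x, hx, y, hy, hxy⟩ := Finset.one_lt_card.1 hc
  rcases sub_of_conn G {x} (T.erase x) T
    (fun u hu w hw => by
      rw [Finset.mem_singleton] at hu; subst hu
      exact h _ (hs hx) _ (hs (Finset.mem_of_mem_erase hw)))
    (fun u hu => by
      by_cases e : u = x
      · simp [e]
      · simp [e, hu]) hconn with h' | h'
  · exact hxy (Finset.mem_singleton.1 (h' hy)).symm
  · exact absurd (h' hx) (by simp)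

lemma nonadj_of_CS_empty {V : Type*} [Fintype V] [DecidableEq V] (G : SimpleGraph V)
    (S : Finset V) (h : CS G S = ∅) : ∀ x ∈ S, ∀ y ∈ S, ¬ G.Adj x y := by
  intro x hx y hy e
  have : ({x, y} : Finset V) ∈ CS G S := by
    rw [mem_CS]
    refine ⟨⟨by rw [Finset.card_pair e.ne], ?_⟩, ?_⟩
    · refine conn_of_join G {x} {y} {x, y} ?_ ?_ ⟨x, by simp, by simp⟩ ⟨y, by simp, by simp⟩
      · simpa using e
      · simp
    · intro z hz
      simp at hz
      rcases hz with rfl | rfl <;> assumption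
  rw [h] at this
  simp at this

lemma mean_iso {V W : Type*} [Fintype V] [Fintype W] (G : SimpleGraph V) (H : SimpleGraph W)
    (e : G ≃g H) : mstarMean G = mstarMean H := by
  have hm : ∀ T : Finset V, T ∈ mstarSets G ↔
      Equiv.finsetCongr e.toEquiv T ∈ mstarSets H := by
    intro T
    rw [mem_mstar, mem_mstar]
    have i : G.induce (T : Set V) ≃g H.induce ((Equiv.finsetCongr e.toEquiv T : Finset W) : Set W) :=
      ⟨e.toEquiv.subtypeEquiv (by intro a; simp), by
        intro a b; exact e.map_adj_iff⟩
    rw [i.connected_iff]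
    simp
  unfold mstarMean
  rw [Finset.sum_equiv (Equiv.finsetCongr e.toEquiv) hm
      (g := fun S => (S.card : ℝ)) (by intro T _; simp),
    Finset.card_equiv (Equiv.finsetCongr e.toEquiv) hm]

theorem stmt_14 {V : Type*} [Fintype V] [DecidableEq V] (G : SimpleGraph V) (n s : ℕ)
    (hn : 4 ≤ n) (hs1 : 2 ≤ s) (hs2 : s ≤ n - 2)
    (hcard : Fintype.card V = n) (hcog : IsCograph G)
    (A : Finset V) (hAcard : A.card = s)
    (hjoin : ∀ u ∈ A, ∀ w ∉ A, G.Adj u w) :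
    mstarMean G ≤ mstarMean (completeBipartiteGraph (Fin s) (Fin (n - s))) ∧
      (mstarMean G = mstarMean (completeBipartiteGraph (Fin s) (Fin (n - s))) ↔
        Nonempty (G ≃g completeBipartiteGraph (Fin s) (Fin (n - s)))) := by
  classical
  obtain ⟨t, rfl⟩ : ∃ t, n = s + t := ⟨n - s, by omega⟩
  have ht : 2 ≤ t := by omega
  rw [show s + t - s = t by omega]
  have hB : Aᶜ.card = t := by rw [Finset.card_compl]; omega
  have hP4 := noP4_of_cograph G hcog
  -- the bipartite graph
  let L : Finset (Fin s ⊕ Fin t) := Finset.univ.filter (fun x => x.isLeft = true)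
  have memL : ∀ x, x ∈ L ↔ x.isLeft = true := by intro x; simp [L]
  have hL : L.card = s := by
    have : L = Finset.univ.map Function.Embedding.inl := by
      ext x; cases x <;> simp [L]
    rw [this]; simp
  have hLc : Lᶜ.card = t := by rw [Finset.card_compl, hL]; simp
  have hLj : ∀ u ∈ L, ∀ w ∉ L, (completeBipartiteGraph (Fin s) (Fin t)).Adj u w := by
    intro u hu w hw
    rw [memL] at hu hw
    cases u <;> cases w <;> simp_all
  have cL : CS (completeBipartiteGraph (Fin s) (Fin t)) L = ∅ := by
    apply CS_empty_of
    intro u hu w hw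
    rw [memL] at hu hw
    cases u <;> cases w <;> simp_all
  have cLc : CS (completeBipartiteGraph (Fin s) (Fin t)) Lᶜ = ∅ := by
    apply CS_empty_of
    intro u hu w hw
    rw [Finset.mem_compl, memL] at hu hw
    cases u <;> cases w <;> simp_all
  have kS := mean_formula _ L s t hL hLc hLj (1 / 2) 0
  have kN := mean_formula _ L s t hL hLc hLj 0 1
  have gS := mean_formula G A s t hAcard hB hjoin (1 / 2) 0
  have gN := mean_formula G A s t hAcard hB hjoin 0 1
  have s2 : (2 : ℝ) ≤ s := by exact_mod_cast hs1
  have t2 : (2 : ℝ) ≤ t := by exact_mod_cast ht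
  have b1 := key_bound G hP4 A (s + t) (by rw [hAcard]; linarith)
  have b2 := key_bound G hP4 Aᶜ (s + t) (by rw [hB]; linarith)
  have x1 := le_two_pow s
  have y1 := le_two_pow t
  simp only [cL, cLc, Finset.sum_empty] at kS kN
  norm_num at kS kN gS gN
  simp only [Finset.sum_add_distrib, ← Finset.mul_sum, Finset.sum_const, nsmul_eq_mul] at b1 b2
  have hmean : ∀ E : ℝ, E = ((CS G A).card : ℝ) + (CS G Aᶜ).card →
      mstarMean G ≤ mstarMean (completeBipartiteGraph (Fin s) (Fin t)) ∧
      (mstarMean G = mstarMean (completeBipartiteGraph (Fin s) (Fin t)) → E = 0) := by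
    intro E hE
    have hE0 : 0 ≤ E := by rw [hE]; positivity
    unfold mstarMean
    rw [kS, kN, gS, gN]
    generalize (2 : ℝ) ^ s = x at *
    generalize (2 : ℝ) ^ t = y at *
    generalize (s : ℝ) = p at *
    generalize (t : ℝ) = q at *
    generalize ∑ T ∈ CS G A, (T.card : ℝ) = X at *
    generalize ∑ T ∈ CS G Aᶜ, (T.card : ℝ) = Y at *
    generalize ((CS G A).card : ℝ) = X' at *
    generalize ((CS G Aᶜ).card : ℝ) = Y' at *
    rw [← hE]
    obtain ⟨N, hN⟩ : ∃ N, N = x * y - x - y + 1 := ⟨_, rfl⟩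
    obtain ⟨U, hU⟩ : ∃ U, U = 1 / 2 * (p + q) * (x * y) - 1 / 2 * p * x - 1 / 2 * q * y := ⟨_, rfl⟩
    obtain ⟨D, hD⟩ : ∃ D, D = p * (y - 1) + q * (x - 1) := ⟨_, rfl⟩
    have hN0 : 0 < N := by
      have : N = (x - 1) * (y - 1) := by rw [hN]; ring
      rw [this]
      exact mul_pos (by linarith) (by linarith)
    have hD0 : 0 < D := by
      have h1 : 0 < p * (y - 1) := mul_pos (by linarith) (by linarith)
      have h2 : 0 < q * (x - 1) := mul_pos (by linarith) (by linarith)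
      linarith
    have hUD : 2 * U = (p + q) * N + D := by rw [hU, hN, hD]; ring
    rw [← hN, ← hU]
    have hZ : 2 * (X + Y) ≤ E * (p + q) := by rw [hE]; linarith
    have hZN : 2 * (X + Y) * N ≤ E * (p + q) * N := mul_le_mul_of_nonneg_right hZ hN0.le
    have hUE : 2 * U * E = (p + q) * N * E + D * E := by rw [hUD]; ring
    have hDE : 0 ≤ D * E := mul_nonneg hD0.le hE0
    constructor
    · rw [div_le_div_iff₀ (by linarith) hN0]
      linarith
    · intro heq
      rw [div_eq_div_iff (by linarith) hN0.ne'] at heq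
      have : D * E = 0 := by linarith
      rcases mul_eq_zero.1 this with h | h
      · linarith
      · exact h
  refine ⟨(hmean _ rfl).1, fun heq => ?_, fun ⟨e⟩ => mean_iso _ _ e⟩
  have h0 := (hmean _ rfl).2 heq
  have hA0 : CS G A = ∅ := by
    rw [← Finset.card_eq_zero]
    have : (CS G A).card + (CS G Aᶜ).card = 0 := by exact_mod_cast h0
    omega
  have hB0 : CS G Aᶜ = ∅ := by
    rw [← Finset.card_eq_zero]
    have : (CS G A).card + (CS G Aᶜ).card = 0 := by exact_mod_cast h0
    omega
  have nA := nonadj_of_CS_empty G A hA0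
  have nB := nonadj_of_CS_empty G Aᶜ hB0
  let e1 : {x // x ∈ A} ≃ Fin s := Fintype.equivFinOfCardEq (by simp [hAcard])
  let e2 : {x // x ∉ A} ≃ Fin t := Fintype.equivFinOfCardEq (by
    rw [Fintype.card_subtype_compl]; simp [hAcard, hcard])
  let e : V ≃ Fin s ⊕ Fin t :=
    (Equiv.sumCompl (fun x => x ∈ A)).symm.trans (Equiv.sumCongr e1 e2)
  refine ⟨⟨e, ?_⟩⟩
  intro u w
  have hl : ∀ u (hu : u ∈ A), e u = Sum.inl (e1 ⟨u, hu⟩) := by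
    intro u hu; simp [e, hu]
  have hr : ∀ u (hu : u ∉ A), e u = Sum.inr (e2 ⟨u, hu⟩) := by
    intro u hu; simp [e, hu]
  by_cases hu : u ∈ A <;> by_cases hw : w ∈ A
  · rw [hl u hu, hl w hw]; simp [nA u hu w hw]
  · rw [hl u hu, hr w hw]; simp [hjoin u hu w hw]
  · rw [hr u hu, hl w hw]; simp [(hjoin w hw u hu).symm]
  · rw [hr u hu, hr w hw]
    simp [nB u (Finset.mem_compl.2 hu) w (Finset.mem_compl.2 hw)]
end

section
/- For every n ≥ 6, M*_{K_{2,n−3}} ≤ M_{K_n}. -/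
open SimpleGraph Finset

lemma two_sum_card (k : ℕ) : 2 * ∑ S : Finset (Fin k), (S.card : ℝ) = k * 2 ^ k := by
  have h : ∑ S : Finset (Fin k), (S.card : ℝ) = ∑ S : Finset (Fin k), ((Sᶜ).card : ℝ) :=
    (Fintype.sum_bijective (fun S : Finset (Fin k) => Sᶜ) compl_bijective _ _ (fun S => rfl)).symm
  rw [two_mul]
  nth_rewrite 2 [h]
  rw [← Finset.sum_add_distrib]
  have h2 : ∀ S : Finset (Fin k), (S.card : ℝ) + ((Sᶜ).card : ℝ) = k := by
    intro S
    have := Finset.card_add_card_compl S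
    rw [Fintype.card_fin] at this
    exact_mod_cast this
  simp [h2, mul_comm]

lemma sum_erase_card (k : ℕ) :
    ∑ S ∈ (univ : Finset (Finset (Fin k))).erase ∅, (S.card : ℝ) = k * 2 ^ k / 2 := by
  rw [← two_sum_card, Finset.sum_erase _ (by simp)]
  ring

lemma card_erase_univ (k : ℕ) :
    (((univ : Finset (Finset (Fin k))).erase ∅).card : ℝ) = 2 ^ k - 1 := by
  rw [Finset.card_erase_of_mem (mem_univ _), Nat.cast_sub]
  · simp
  · simp [Nat.one_le_two_pow]

lemma connSets_top (k : ℕ) :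
    connSets (⊤ : SimpleGraph (Fin k)) = (univ : Finset (Finset (Fin k))).erase ∅ := by
  ext S
  simp only [connSets, Set.Finite.mem_toFinset, Set.mem_ofPred_eq, mem_erase, mem_univ, and_true,
    Finset.nonempty_iff_ne_empty]
  constructor
  · exact fun h => h.1
  · intro h
    refine ⟨h, ?_⟩
    obtain ⟨x, hx⟩ := Finset.nonempty_iff_ne_empty.2 h
    have : Nonempty (S : Set (Fin k)) := ⟨⟨x, hx⟩⟩
    rw [SimpleGraph.induce_top]
    exact SimpleGraph.connected_top

lemma mem_mstar_s15 (m : ℕ) (S : Finset (Fin 2 ⊕ Fin m)) :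
    S ∈ mstarSets (completeBipartiteGraph (Fin 2) (Fin m)) ↔
      S.toLeft ≠ ∅ ∧ S.toRight ≠ ∅ := by
  simp only [mstarSets, Set.Finite.mem_toFinset, Set.mem_ofPred_eq,
    ← Finset.nonempty_iff_ne_empty]
  constructor
  · rintro ⟨h2, hc⟩
    obtain ⟨x, hx, y, hy, hxy⟩ := Finset.one_lt_card.1 h2
    have : Nontrivial (S : Set (Fin 2 ⊕ Fin m)) :=
      ⟨⟨x, hx⟩, ⟨y, hy⟩, fun h => hxy (congrArg Subtype.val h)⟩
    obtain ⟨⟨z, hz⟩, hadj⟩ := hc.preconnected.exists_adj_of_nontrivial ⟨x, hx⟩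
    rcases x with x | x <;> rcases z with z | z <;> simp at hadj
    · exact ⟨⟨x, by simpa using hx⟩, ⟨z, by simpa using hz⟩⟩
    · exact ⟨⟨z, by simpa using hz⟩, ⟨x, by simpa using hx⟩⟩
  · rintro ⟨⟨a, ha⟩, ⟨b, hb⟩⟩
    rw [Finset.mem_toLeft] at ha
    rw [Finset.mem_toRight] at hb
    refine ⟨Finset.one_lt_card.2 ⟨_, ha, _, hb, by simp⟩, ?_⟩
    rw [SimpleGraph.connected_iff_exists_forall_reachable]
    refine ⟨⟨_, ha⟩, ?_⟩
    have hab : ((completeBipartiteGraph (Fin 2) (Fin m)).induce (S : Set _)).Adj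
      ⟨_, ha⟩ ⟨_, hb⟩ := by simp
    rintro ⟨x | x, hx⟩
    · refine hab.reachable.trans (SimpleGraph.Adj.reachable ?_)
      simp
    · refine SimpleGraph.Adj.reachable ?_
      simp

lemma sum_mstar (m : ℕ) (f : ℕ → ℝ) :
    ∑ S ∈ mstarSets (completeBipartiteGraph (Fin 2) (Fin m)), f S.card =
      ∑ A ∈ (univ : Finset (Finset (Fin 2))).erase ∅,
        ∑ B ∈ (univ : Finset (Finset (Fin m))).erase ∅, f (A.card + B.card) := by
  rw [← Finset.sum_product']
  refine Finset.sum_bij' (fun S _ => (S.toLeft, S.toRight)) (fun p _ => p.1.disjSum p.2)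
    ?_ ?_ ?_ ?_ ?_
  · intro S hS
    simpa [mem_mstar_s15] using hS
  · intro p hp
    simpa [mem_mstar_s15] using hp
  · intro S _
    ext x
    rcases x with x | x <;> simp
  · intro p _
    simp
  · intro S _
    simp [Finset.card_toLeft_add_card_toRight]

lemma aux_pow (m : ℕ) (hm : 4 ≤ m) : 3 * m + 1 ≤ 2 ^ m := by
  induction m, hm using Nat.le_induction with
  | base => norm_num
  | succ k hk ih => rw [pow_succ]; omega

theorem stmt_15 (n : ℕ) (hn : 6 ≤ n) :
    mstarMean (completeBipartiteGraph (Fin 2) (Fin (n - 3))) ≤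
      globalMean (⊤ : SimpleGraph (Fin n)) := by
  obtain ⟨m, rfl⟩ : ∃ m, n = m + 3 := ⟨n - 3, by omega⟩
  rw [Nat.add_sub_cancel]
  have hc : ((mstarSets (completeBipartiteGraph (Fin 2) (Fin m))).card : ℝ)
      = 3 * (2 ^ m - 1) := by
    have := sum_mstar m (fun _ => 1)
    simp only [Finset.sum_const, nsmul_eq_mul, mul_one, card_erase_univ] at this
    rw [this]; norm_num
  have hs : ∑ S ∈ mstarSets (completeBipartiteGraph (Fin 2) (Fin m)), (S.card : ℝ)
      = 4 * (2 ^ m - 1) + 3 * (m * 2 ^ m / 2) := by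
    have := sum_mstar m (fun k => (k : ℝ))
    simp only [Nat.cast_add, Finset.sum_add_distrib, Finset.sum_const, nsmul_eq_mul,
      card_erase_univ, sum_erase_card, ← Finset.mul_sum] at this
    rw [this]; norm_num; ring
  rw [mstarMean, globalMean, hc, hs, connSets_top, sum_erase_card, card_erase_univ]
  have hm : 3 ≤ m := by omega
  rcases hm.eq_or_lt with rfl | hm
  · norm_num
  · have key : (3 * m + 1 : ℝ) ≤ 2 ^ m := by
      have := aux_pow m hm
      exact_mod_cast this
    have hm' : (4 : ℝ) ≤ m := by exact_mod_cast hm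
    rw [pow_add]
    generalize (2 : ℝ) ^ m = x at *
    push_cast
    rw [div_le_div_iff₀ (by linarith) (by linarith)]
    nlinarith [mul_nonneg (sub_nonneg.2 key) (by linarith : (0:ℝ) ≤ x)]
end

section
/- Let G be a connected cograph of order n ≥ 3 that has a cut vertex (a vertex whose deletion disconnects G). Then M_G ≥ M_{S_n}, with equality if and only if G is isomorphic to S_n. -/
open SimpleGraph Finset

namespace Sk

/-- `U` splits into two nonempty parts without edges between. -/
def Split {V : Type*} [DecidableEq V] (G : SimpleGraph V) (U : Finset V) : Prop :=
  ∃ X Y : Finset V, X.Nonempty ∧ Y.Nonempty ∧ Disjoint X Y ∧ X ∪ Y = U ∧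
    ∀ x ∈ X, ∀ y ∈ Y, ¬ G.Adj x y

def P4free {V : Type*} (G : SimpleGraph V) : Prop :=
  ∀ a b c d : V, G.Adj a b → G.Adj b c → G.Adj c d → ¬ G.Adj a c → ¬ G.Adj a d → ¬ G.Adj b d →
    a ≠ c → a ≠ d → b ≠ d → False

theorem p4free_of_cograph {V : Type*} {G : SimpleGraph V} (h : IsCograph G) : P4free G := by
  intro a b c d hab hbc hcd hac had hbd nac nad nbd
  have e1 := hab.ne
  have e2 := hbc.ne
  have e3 := hcd.ne
  refine h.false ⟨⟨![a, b, c, d], ?_⟩, ?_⟩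
  · intro i j hij
    fin_cases i <;> fin_cases j <;> simp_all
    all_goals grind
  · intro i j
    rw [SimpleGraph.pathGraph_adj]
    change G.Adj (![a, b, c, d] i) (![a, b, c, d] j) ↔ _
    have r1 := hab.symm
    have r2 := hbc.symm
    have r3 := hcd.symm
    have r4 : ¬ G.Adj c a := fun hh => hac hh.symm
    have r5 : ¬ G.Adj d a := fun hh => had hh.symm
    have r6 : ¬ G.Adj d b := fun hh => hbd hh.symm
    fin_cases i <;> fin_cases j <;> simp [*]

theorem P4free.compl {V : Type*} {G : SimpleGraph V} (h : P4free G) : P4free Gᶜ := by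
  intro a b c d hab hbc hcd hac had hbd nac nad nbd
  simp only [SimpleGraph.compl_adj] at *
  exact h b d a c (by tauto) (by have := G.adj_comm a d; tauto) (by tauto)
    (by have := G.adj_comm a b; tauto) (by tauto) (by have := G.adj_comm c d; tauto)
    (by tauto) (by tauto) (by tauto)

theorem step {V : Type*} [DecidableEq V] {G : SimpleGraph V} (h : P4free G) (W : Finset V) (v : V)
    (hv : v ∉ W) (hW : Split G W) : Split G (insert v W) ∨ Split Gᶜ (insert v W) := by
  by_cases hall : ∀ w ∈ W, G.Adj v w
  · right
    obtain ⟨X, Y, ⟨x, hx⟩, -, -, hU, -⟩ := hW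
    refine ⟨{v}, W, by simp, ⟨x, by grind⟩, by simpa using hv, by ext; simp, ?_⟩
    intro x hx y hy
    simp only [Finset.mem_singleton] at hx
    subst hx
    simp [SimpleGraph.compl_adj, hall y hy]
  push Not at hall
  obtain ⟨w, hw, hvw⟩ := hall
  left
  by_contra hns
  -- minimal closed set
  let P : Finset V → Prop := fun C => w ∈ C ∧ C ⊆ W ∧ ∀ x ∈ C, ∀ y ∈ W \ C, ¬ G.Adj x y
  obtain ⟨C, hC, hmin⟩ : ∃ C, P C ∧ ∀ D, P D → D ⊆ C → D = C := by
    have hP : ∃ C, P C := ⟨W, hw, subset_rfl, by simp⟩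
    obtain ⟨C, hC, hm⟩ := WellFounded.has_min (wellFounded_lt (α := Finset V)) {C | P C} hP
    refine ⟨C, hC, fun D hD hDC => ?_⟩
    by_contra hne
    exact hm D hD (lt_of_le_of_ne hDC hne)
  obtain ⟨hwC, hCW, hcl⟩ := hC
  have hCne : ∃ y ∈ W, y ∉ C := by
    by_contra hcon
    push Not at hcon
    obtain ⟨X, Y, ⟨x, hx⟩, ⟨y, hy⟩, hd, hU, hXY⟩ := hW
    rw [Finset.disjoint_left] at hd
    have hw' : w ∈ X ∪ Y := hU ▸ hw
    rcases Finset.mem_union.1 hw' with hwX | hwY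
    · have := hmin X ⟨hwX, by grind, fun a ha b hb => hXY a ha b (by grind)⟩ (by grind)
      have := hcon y (by grind)
      grind
    · have := hmin Y ⟨hwY, by grind, fun a ha b hb hab => hXY b (by grind) a ha hab.symm⟩ (by grind)
      have := hcon x (by grind)
      grind
  obtain ⟨y0, hy0, hy0C⟩ := hCne
  have h1 : ∃ u ∈ W, u ∉ C ∧ G.Adj v u := by
    by_contra hcon
    push Not at hcon
    refine hns ⟨insert v C, W \ C, by simp, ⟨y0, by grind⟩, ?_, by grind, ?_⟩
    · rw [Finset.disjoint_left]; grind
    · intro x hx y hy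
      rcases Finset.mem_insert.1 hx with rfl | hx
      · exact hcon y (by grind) (by grind)
      · exact hcl x hx y hy
  obtain ⟨u, huW, huC, hvu⟩ := h1
  have h2 : ∃ z ∈ C, G.Adj v z := by
    by_contra hcon
    push Not at hcon
    refine hns ⟨C, insert v (W \ C), ⟨w, hwC⟩, by simp, ?_, by grind, ?_⟩
    · rw [Finset.disjoint_left]; grind
    · intro x hx y hy hxy
      rcases Finset.mem_insert.1 hy with rfl | hy
      · exact hcon x hx hxy.symm
      · exact hcl x hx y hy hxy
  obtain ⟨z0, hz0, hvz0⟩ := h2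
  classical
  have h3 : ∃ z' ∈ C, ∃ z ∈ C, ¬ G.Adj v z' ∧ G.Adj v z ∧ G.Adj z' z := by
    by_contra hcon
    push Not at hcon
    have := hmin (C.filter (fun x => ¬ G.Adj v x)) ⟨by simp [hwC, hvw], by grind, ?_⟩ (by grind)
    · have : z0 ∈ C.filter (fun x => ¬ G.Adj v x) := by rw [this]; exact hz0
      grind
    · intro x hx y hy
      simp only [Finset.mem_filter, Finset.mem_sdiff] at hx hy
      by_cases hyC : y ∈ C
      · exact hcon x hx.1 y hyC hx.2 (by tauto)
      · exact hcl x hx.1 y (by grind)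
  obtain ⟨z', hz', z, hz, hvz', hvz, hzz⟩ := h3
  have huz : ¬ G.Adj u z := fun hh => hcl z hz u (by grind) hh.symm
  have huz' : ¬ G.Adj u z' := fun hh => hcl z' hz' u (by grind) hh.symm
  exact h u v z z' hvu.symm hvz hzz.symm huz huz' hvz' (by grind) (by grind) (by grind)

theorem seinsche {V : Type*} [DecidableEq V] {G : SimpleGraph V} (h : P4free G) (U : Finset V) :
    2 ≤ U.card → Split G U ∨ Split Gᶜ U := by
  induction U using Finset.induction_on with
  | empty => simp
  | insert v W hv ih =>
    intro hc
    rw [Finset.card_insert_of_notMem hv] at hc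
    by_cases hW : 2 ≤ W.card
    · rcases ih hW with h1 | h1
      · exact step h W v hv h1
      · have := step h.compl W v hv h1
        rw [compl_compl] at this
        exact this.symm
    · obtain ⟨w, rfl⟩ := Finset.card_eq_one.1 (show W.card = 1 by omega)
      have hvw : v ≠ w := by simpa using hv
      by_cases ha : G.Adj v w
      · right
        exact ⟨{v}, {w}, by simp, by simp, by simpa using hvw, by ext; simp, by simp [ha]⟩
      · left
        exact ⟨{v}, {w}, by simp, by simp, by simpa using hvw, by ext; simp, by simp [ha]⟩

theorem connected_iff {V : Type*} [DecidableEq V] (G : SimpleGraph V) (S : Finset V)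
    (hS : S.Nonempty) : (G.induce (S : Set V)).Connected ↔ ¬ Split G S := by
  constructor
  · rintro hc ⟨X, Y, ⟨x, hx⟩, ⟨y, hy⟩, hd, rfl, hXY⟩
    rw [Finset.disjoint_left] at hd
    have key : ∀ a b : ((X ∪ Y : Finset V) : Set V),
        (G.induce ((X ∪ Y : Finset V) : Set V)).Walk a b → a.1 ∈ X → b.1 ∈ X := by
      intro a b p
      induction p with
      | nil => exact id
      | @cons a b c hab p ih =>
        intro ha
        apply ih
        by_contra hb
        have := b.2
        simp only [Finset.mem_coe, Finset.mem_union] at this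
        exact hXY _ ha _ (by tauto) hab
    obtain ⟨p⟩ := hc.preconnected ⟨x, by simp [hx]⟩ ⟨y, by simp [hy]⟩
    exact hd (key _ _ p hx) hy
  · intro hns
    obtain ⟨s, hs⟩ := hS
    by_contra hc
    classical
    let X : Finset V := S.filter (fun x => ∃ hx : x ∈ S,
      (G.induce (S : Set V)).Reachable ⟨s, hs⟩ ⟨x, hx⟩)
    have hsX : s ∈ X := by simp [X, hs]
    apply hns
    refine ⟨X, S \ X, ⟨s, hsX⟩, ?_, Finset.disjoint_sdiff,
      by simp [X], ?_⟩
    · by_contra hne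
      apply hc
      rw [SimpleGraph.connected_iff_exists_forall_reachable]
      refine ⟨⟨s, hs⟩, fun ⟨y, hy⟩ => ?_⟩
      have : y ∈ X := by
        by_contra hyX
        exact hne ⟨y, by simp only [Finset.mem_sdiff]; exact ⟨hy, hyX⟩⟩
      simp only [X, Finset.mem_filter] at this
      exact this.2.2
    · intro x hx y hy hxy
      simp only [X, Finset.mem_filter, Finset.mem_sdiff] at hx hy
      apply hy.2
      obtain ⟨_, hx2, hr⟩ := hx
      refine ⟨hy.1, hy.1, hr.trans ?_⟩
      exact SimpleGraph.Adj.reachable (by simpa using hxy)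

open Classical in
noncomputable def disc {V : Type*} [DecidableEq V] (G : SimpleGraph V) (U : Finset V) :
    Finset (Finset V) := U.powerset.filter (Split G)

theorem mem_disc {V : Type*} [DecidableEq V] (G : SimpleGraph V) (U S : Finset V) :
    S ∈ disc G U ↔ S ⊆ U ∧ Split G S := by
  simp [disc]

theorem Split.two_le {V : Type*} [DecidableEq V] {G : SimpleGraph V} {S : Finset V}
    (h : Split G S) : 2 ≤ S.card := by
  obtain ⟨X, Y, hX, hY, hd, rfl, -⟩ := h
  rw [Finset.card_union_of_disjoint hd]
  have := hX.card_pos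
  have := hY.card_pos
  omega

/-- In a join no split set meets both sides. -/
theorem join_split {V : Type*} [DecidableEq V] {G : SimpleGraph V} {S : Finset V}
    (h : Split G S) {x y : V} {X Y : Finset V} (hXY : ∀ x ∈ X, ∀ y ∈ Y, G.Adj x y)
    (hS : S ⊆ X ∪ Y) (hx : x ∈ S) (hy : y ∈ S) (hxX : x ∈ X) (hyY : y ∈ Y) : False := by
  obtain ⟨P, Q, ⟨p, hp⟩, ⟨q, hq⟩, hd, rfl, hPQ⟩ := h
  have hxy := hXY x hxX y hyY
  have hp1 := hS (Finset.mem_union_left _ hp)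
  have hq1 := hS (Finset.mem_union_right _ hq)
  have h1 : ∀ a ∈ P ∪ Q, ∀ b ∈ P ∪ Q, a ∈ X → b ∈ Y → (a ∈ P ↔ b ∈ P) := by
    intro a ha b hb haX hbY
    have hab := hXY a haX b hbY
    have h2 := hPQ a
    have h3 := fun h1 h2 => hPQ b h1 a h2 hab.symm
    grind
  rw [Finset.disjoint_left] at hd
  grind

theorem disc_join {V : Type*} [DecidableEq V] {G : SimpleGraph V} {X Y : Finset V}
    (hXY : ∀ x ∈ X, ∀ y ∈ Y, G.Adj x y) : disc G (X ∪ Y) = disc G X ∪ disc G Y := by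
  ext S
  simp only [mem_disc, Finset.mem_union]
  constructor
  · rintro ⟨hS, hs⟩
    by_cases h1 : S ⊆ X
    · exact Or.inl ⟨h1, hs⟩
    by_cases h2 : S ⊆ Y
    · exact Or.inr ⟨h2, hs⟩
    obtain ⟨y, hy, hyX⟩ := Finset.not_subset.1 h1
    obtain ⟨x, hx, hxY⟩ := Finset.not_subset.1 h2
    exact (join_split hs hXY hS hx hy (by grind) (by grind)).elim
  · rintro (⟨h, hs⟩ | ⟨h, hs⟩)
    · exact ⟨h.trans Finset.subset_union_left, hs⟩
    · exact ⟨h.trans Finset.subset_union_right, hs⟩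

theorem disc_disjoint {V : Type*} [DecidableEq V] {G : SimpleGraph V} {X Y : Finset V}
    (hd : Disjoint X Y) : Disjoint (disc G X) (disc G Y) := by
  rw [Finset.disjoint_left] at *
  intro S h1 h2
  rw [mem_disc] at h1 h2
  have := h1.2.two_le
  obtain ⟨x, hx⟩ : S.Nonempty := Finset.card_pos.1 (by omega)
  exact hd (h1.1 hx) (h2.1 hx)

theorem sum_disc_union {V : Type*} [DecidableEq V] {G : SimpleGraph V} {X Y : Finset V}
    (hd : Disjoint X Y) (hXY : ∀ x ∈ X, ∀ y ∈ Y, ¬ G.Adj x y) (f : Finset V → ℤ) :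
    ∑ S ∈ disc G (X ∪ Y), f S = ∑ S ∈ disc G X, f S + ∑ S ∈ disc G Y, f S +
      ∑ p ∈ (X.powerset.erase ∅) ×ˢ (Y.powerset.erase ∅), f (p.1 ∪ p.2) := by
  have hd' := Finset.disjoint_left.1 hd
  have e : disc G (X ∪ Y) = (disc G X ∪ disc G Y) ∪
      ((X.powerset.erase ∅) ×ˢ (Y.powerset.erase ∅)).image (fun p => p.1 ∪ p.2) := by
    ext S
    simp only [mem_disc, Finset.mem_union, Finset.mem_image, Finset.mem_product,
      Finset.mem_erase, Finset.mem_powerset, Prod.exists]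
    constructor
    · rintro ⟨hS, hs⟩
      by_cases h1 : S ⊆ X
      · exact Or.inl (Or.inl ⟨h1, hs⟩)
      by_cases h2 : S ⊆ Y
      · exact Or.inl (Or.inr ⟨h2, hs⟩)
      obtain ⟨y, hy, hyX⟩ := Finset.not_subset.1 h1
      obtain ⟨x, hx, hxY⟩ := Finset.not_subset.1 h2
      refine Or.inr ⟨S ∩ X, S ∩ Y, ⟨⟨?_, by grind⟩, ⟨?_, by grind⟩⟩, by grind⟩
      · exact Finset.nonempty_iff_ne_empty.1 ⟨x, by grind⟩
      · exact Finset.nonempty_iff_ne_empty.1 ⟨y, by grind⟩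
    · rintro ((⟨h, hs⟩ | ⟨h, hs⟩) | ⟨A, B, ⟨⟨hA, hAX⟩, ⟨hB, hBY⟩⟩, rfl⟩)
      · exact ⟨h.trans Finset.subset_union_left, hs⟩
      · exact ⟨h.trans Finset.subset_union_right, hs⟩
      · refine ⟨Finset.union_subset_union hAX hBY, A, B, Finset.nonempty_iff_ne_empty.2 hA,
          Finset.nonempty_iff_ne_empty.2 hB, Finset.disjoint_of_subset_left hAX
            (Finset.disjoint_of_subset_right hBY hd), rfl, fun x hx y hy => hXY x (hAX hx) y (hBY hy)⟩
  rw [e, Finset.sum_union, Finset.sum_union (disc_disjoint hd), Finset.sum_image]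
  · rintro ⟨A, B⟩ h1 ⟨A', B'⟩ h2 h3
    simp only [Finset.coe_product, Set.mem_prod, Finset.mem_coe, Finset.mem_erase,
      Finset.mem_powerset] at h1 h2 h3
    have : A = A' := by
      ext a
      have := Finset.ext_iff.1 h3 a
      grind
    have : B = B' := by
      ext a
      have := Finset.ext_iff.1 h3 a
      grind
    simp_all
  · rw [Finset.disjoint_left]
    intro S h1 h2
    simp only [mem_disc, Finset.mem_union, Finset.mem_image, Finset.mem_product,
      Finset.mem_erase, Finset.mem_powerset, Prod.exists] at h1 h2
    obtain ⟨A, B, ⟨⟨hA, hAX⟩, ⟨hB, hBY⟩⟩, rfl⟩ := h2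
    obtain ⟨a, ha⟩ := Finset.nonempty_iff_ne_empty.2 hA
    obtain ⟨b, hb⟩ := Finset.nonempty_iff_ne_empty.2 hB
    rcases h1 with h | h
    · exact hd' (h.1 (Finset.mem_union_right _ hb)) (hBY hb)
    · exact hd' (hAX ha) (h.1 (Finset.mem_union_left _ ha))

theorem sum_pow {V : Type*} [DecidableEq V] (X : Finset V) :
    ∑ S ∈ X.powerset, (2 * (S.card : ℤ) - X.card) = 0 := by
  induction X using Finset.induction_on with
  | empty => simp
  | insert a X ha ih =>
    rw [Finset.sum_powerset_insert ha, ← Finset.sum_add_distrib,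
      Finset.sum_congr rfl (g := fun S => 2 * (2 * (S.card : ℤ) - X.card)), ← Finset.mul_sum, ih]
    · rfl
    · intro S hS
      have : a ∉ S := fun h => ha (Finset.mem_powerset.1 hS h)
      rw [Finset.card_insert_of_notMem this, Finset.card_insert_of_notMem ha]
      push_cast
      ring

theorem sum_pow_erase {V : Type*} [DecidableEq V] (X : Finset V) :
    ∑ S ∈ X.powerset.erase ∅, (2 * (S.card : ℤ) - X.card) = X.card := by
  have := Finset.add_sum_erase X.powerset (fun S => 2 * (S.card : ℤ) - X.card)
    (a := ∅) (by simp)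
  rw [sum_pow] at this
  simp only [Finset.card_empty] at this
  push_cast at this
  linarith

theorem card_pow_erase {V : Type*} [DecidableEq V] (X : Finset V) :
    ((X.powerset.erase ∅).card : ℤ) = 2 ^ X.card - 1 := by
  rw [Finset.card_erase_of_mem (by simp), Finset.card_powerset, Nat.cast_sub Nat.one_le_two_pow]
  simp

theorem sum_cross {V : Type*} [DecidableEq V] {X Y : Finset V} (hd : Disjoint X Y) (c : ℤ) :
    ∑ p ∈ (X.powerset.erase ∅) ×ˢ (Y.powerset.erase ∅),
      (2 * ((p.1 ∪ p.2).card : ℤ) - X.card - Y.card - c) =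
    X.card * (2 ^ Y.card - 1) + Y.card * (2 ^ X.card - 1)
      - c * ((2 ^ X.card - 1) * (2 ^ Y.card - 1)) := by
  have : ∀ p ∈ (X.powerset.erase ∅) ×ˢ (Y.powerset.erase ∅),
      (2 * ((p.1 ∪ p.2).card : ℤ) - X.card - Y.card - c) =
      (2 * (p.1.card : ℤ) - X.card) + (2 * (p.2.card : ℤ) - Y.card) - c := by
    rintro ⟨A, B⟩ h
    simp only [Finset.mem_product, Finset.mem_erase, Finset.mem_powerset] at h
    have : Disjoint A B := Finset.disjoint_of_subset_left h.1.2
      (Finset.disjoint_of_subset_right h.2.2 hd)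
    simp only [Finset.card_union_of_disjoint this]
    push_cast
    ring
  rw [Finset.sum_congr rfl this, Finset.sum_sub_distrib, Finset.sum_add_distrib,
    Finset.sum_product, Finset.sum_product]
  simp only [Finset.sum_const, nsmul_eq_mul, sum_pow_erase, card_pow_erase, Finset.card_product]
  rw [← Finset.mul_sum, sum_pow_erase]
  push_cast
  rw [card_pow_erase, card_pow_erase]
  ring

theorem two_pow_ge (a : ℕ) : (a : ℤ) ≤ 2 ^ a - 1 := by
  have := Nat.lt_two_pow_self (n := a)
  have : ((a + 1 : ℕ) : ℤ) ≤ ((2 ^ a : ℕ) : ℤ) := by exact_mod_cast this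
  push_cast at this
  linarith

theorem E_mono {V : Type*} [DecidableEq V] (T : Finset (Finset V)) (a c : ℤ)
    (h : ∑ S ∈ T, (2 * (S.card : ℤ) - a) ≤ 0) (hc : a ≤ c) :
    ∑ S ∈ T, (2 * (S.card : ℤ) - c) ≤ 0 :=
  le_trans (Finset.sum_le_sum fun S _ => by linarith) h

theorem E2 {V : Type*} [DecidableEq V] {G : SimpleGraph V} (h : P4free G) (U : Finset V) :
    ∑ S ∈ disc G U, (2 * (S.card : ℤ) - (U.card + 2)) ≤ 0 := by
  induction U using Finset.strongInduction with
  | H U ih =>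
  by_cases hU : 2 ≤ U.card
  · have hsub : ∀ X Y : Finset V, X.Nonempty → Y.Nonempty → Disjoint X Y → X ∪ Y = U →
        X ⊂ U ∧ Y ⊂ U := by
      rintro X Y ⟨x, hx⟩ ⟨y, hy⟩ hd rfl
      rw [Finset.disjoint_left] at hd
      constructor
      · exact (Finset.ssubset_iff_of_subset Finset.subset_union_left).2 ⟨y, by grind⟩
      · exact (Finset.ssubset_iff_of_subset Finset.subset_union_right).2 ⟨x, by grind⟩
    rcases seinsche h U hU with ⟨X, Y, hX, hY, hd, hXY, hn⟩ | ⟨X, Y, hX, hY, hd, hXY, hn⟩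
    · obtain ⟨s1, s2⟩ := hsub X Y hX hY hd hXY
      have i1 := E_mono _ _ (U.card + 2) (ih X s1) (by
        have := Finset.card_le_card s1.1; push_cast; linarith [(Nat.cast_le (α := ℤ)).2 this])
      have i2 := E_mono _ _ (U.card + 2) (ih Y s2) (by
        have := Finset.card_le_card s2.1; push_cast; linarith [(Nat.cast_le (α := ℤ)).2 this])
      subst hXY
      rw [sum_disc_union hd hn]
      have h3 := sum_cross hd 2
      rw [Finset.sum_congr rfl (g := fun p => (2 * ((p.1 ∪ p.2).card : ℤ) - ((X ∪ Y).card + 2)))]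
        at h3
      · rw [h3]
        have a1 := two_pow_ge X.card
        have a2 := two_pow_ge Y.card
        nlinarith
      · intro p _
        rw [Finset.card_union_of_disjoint hd]; push_cast; ring
    · obtain ⟨s1, s2⟩ := hsub X Y hX hY hd hXY
      have i1 := E_mono _ _ (U.card + 2) (ih X s1) (by
        have := Finset.card_le_card s1.1; push_cast; linarith [(Nat.cast_le (α := ℤ)).2 this])
      have i2 := E_mono _ _ (U.card + 2) (ih Y s2) (by
        have := Finset.card_le_card s2.1; push_cast; linarith [(Nat.cast_le (α := ℤ)).2 this])
      have hj : ∀ x ∈ X, ∀ y ∈ Y, G.Adj x y := by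
        intro x hx y hy
        have hne : x ≠ y := fun e => Finset.disjoint_left.1 hd hx (e ▸ hy)
        have := hn x hx y hy
        rw [SimpleGraph.compl_adj] at this
        tauto
      have e : disc G U = disc G X ∪ disc G Y := by rw [← hXY]; exact disc_join hj
      rw [e, Finset.sum_union (disc_disjoint hd)]
      linarith
  · have : disc G U = ∅ := by
      ext S
      simp only [mem_disc, Finset.notMem_empty, iff_false]
      rintro ⟨h1, h2⟩
      have := h2.two_le
      have := Finset.card_le_card h1
      omega
    simp [this]

/-- The decomposition of a graph with a dominating cut vertex. -/
structure Dec {V : Type*} [Fintype V] [DecidableEq V] (G : SimpleGraph V) (v : V)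
    (X Y : Finset V) : Prop where
  hX : X.Nonempty
  hY : Y.Nonempty
  hd : Disjoint X Y
  hU : X ∪ Y = Finset.univ.erase v
  hn : ∀ x ∈ X, ∀ y ∈ Y, ¬ G.Adj x y
  hv : ∀ x, x ≠ v → G.Adj v x

theorem disc_single {V : Type*} [DecidableEq V] (G : SimpleGraph V) (v : V) :
    disc G {v} = ∅ := by
  ext S
  simp only [mem_disc, Finset.notMem_empty, iff_false]
  rintro ⟨h1, h2⟩
  have := h2.two_le
  have := Finset.card_le_card h1
  simp at this
  omega

theorem Dec.disc_univ {V : Type*} [Fintype V] [DecidableEq V] {G : SimpleGraph V} {v : V}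
    {X Y : Finset V} (D : Dec G v X Y) : disc G Finset.univ = disc G (X ∪ Y) := by
  have : (Finset.univ : Finset V) = {v} ∪ (X ∪ Y) := by
    rw [D.hU]; ext x; simp [em]
  rw [this, disc_join, disc_single, Finset.empty_union]
  intro x hx y hy
  rw [D.hU] at hy
  simp only [Finset.mem_singleton] at hx
  subst hx
  exact D.hv y (by simpa using hy)

theorem Dec.card {V : Type*} [Fintype V] [DecidableEq V] {G : SimpleGraph V} {v : V}
    {X Y : Finset V} (D : Dec G v X Y) : Fintype.card V = X.card + Y.card + 1 := by
  have h := congrArg Finset.card D.hU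
  rw [Finset.card_union_of_disjoint D.hd, Finset.card_erase_of_mem (Finset.mem_univ _),
    Finset.card_univ] at h
  have : 0 < Fintype.card V := Fintype.card_pos_iff.2 ⟨v⟩
  omega

theorem Dec.d {V : Type*} [Fintype V] [DecidableEq V] {G : SimpleGraph V} {v : V}
    {X Y : Finset V} (D : Dec G v X Y) : ((disc G Finset.univ).card : ℤ) =
      (disc G X).card + (disc G Y).card + (2 ^ X.card - 1) * (2 ^ Y.card - 1) := by
  have := sum_disc_union D.hd D.hn (fun _ => 1)
  rw [D.disc_univ]
  simp only [Finset.sum_const, nsmul_eq_mul, mul_one, Finset.card_product] at this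
  push_cast at this
  rw [this, card_pow_erase, card_pow_erase]

theorem Dec.s {V : Type*} [Fintype V] [DecidableEq V] {G : SimpleGraph V} {v : V}
    {X Y : Finset V} (D : Dec G v X Y) :
    ∑ S ∈ disc G Finset.univ, (2 * (S.card : ℤ) - Fintype.card V) =
      ∑ S ∈ disc G X, (2 * (S.card : ℤ) - Fintype.card V) +
      ∑ S ∈ disc G Y, (2 * (S.card : ℤ) - Fintype.card V) +
      (X.card * (2 ^ Y.card - 1) + Y.card * (2 ^ X.card - 1)
      - (2 ^ X.card - 1) * (2 ^ Y.card - 1)) := by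
  rw [D.disc_univ, sum_disc_union D.hd D.hn]
  congr 1
  rw [← one_mul (((2:ℤ) ^ X.card - 1) * (2 ^ Y.card - 1)), ← sum_cross D.hd 1]
  apply Finset.sum_congr rfl
  intro p _
  rw [D.card]; push_cast; ring

/-- The key bound. -/
theorem Dec.s_le {V : Type*} [Fintype V] [DecidableEq V] {G : SimpleGraph V} {v : V}
    {X Y : Finset V} (D : Dec G v X Y) (h : P4free G) :
    ∑ S ∈ disc G Finset.univ, (2 * (S.card : ℤ) - Fintype.card V) ≤ Fintype.card V - 2 := by
  rw [D.s]
  have p1 : 1 ≤ X.card := D.hX.card_pos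
  have p2 : 1 ≤ Y.card := D.hY.card_pos
  have i1 := E_mono _ _ (Fintype.card V) (E2 h X) (by rw [D.card]; push_cast; omega)
  have i2 := E_mono _ _ (Fintype.card V) (E2 h Y) (by rw [D.card]; push_cast; omega)
  have q : ∀ a : ℕ, 1 ≤ a → (2 * a : ℤ) ≤ 2 ^ a := by
    intro a ha
    obtain ⟨b, rfl⟩ : ∃ b, a = b + 1 := ⟨a - 1, by omega⟩
    have := two_pow_ge b
    rw [pow_succ]; push_cast; linarith
  have q1 := q _ p1
  have q2 := q _ p2
  have hc : (Fintype.card V : ℤ) = X.card + Y.card + 1 := by exact_mod_cast D.card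
  have p1' : (1 : ℤ) ≤ X.card := by exact_mod_cast p1
  have p2' : (1 : ℤ) ≤ Y.card := by exact_mod_cast p2
  have m : ((X.card : ℤ) - 1) * (Y.card - 1) ≤ (2 ^ X.card - 1 - X.card) * (2 ^ Y.card - 1 - Y.card) :=
    mul_le_mul (by linarith) (by linarith) (by linarith) (by linarith)
  nlinarith

theorem conn_eq {V : Type*} [Fintype V] [DecidableEq V] (G : SimpleGraph V) :
    (Finset.univ : Finset V).powerset.erase ∅ = connSets G ∪ disc G Finset.univ ∧
      Disjoint (connSets G) (disc G Finset.univ) := by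
  have hm : ∀ S, S ∈ connSets G ↔ S.Nonempty ∧ ¬ Split G S := by
    intro S
    simp only [connSets, Set.Finite.mem_toFinset, Set.mem_setOf_eq]
    constructor
    · rintro ⟨h1, h2⟩; exact ⟨h1, (connected_iff G S h1).1 h2⟩
    · rintro ⟨h1, h2⟩; exact ⟨h1, (connected_iff G S h1).2 h2⟩
  constructor
  · ext S
    simp only [Finset.mem_union, hm, mem_disc, Finset.mem_erase, Finset.mem_powerset,
      Finset.subset_univ, true_and, and_true, ← Finset.nonempty_iff_ne_empty]
    constructor
    · tauto
    · rintro (h | h)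
      · exact h.1
      · exact Finset.card_pos.1 (by have := h.two_le; omega)
  · rw [Finset.disjoint_left]
    intro S h1 h2
    exact ((hm S).1 h1).2 ((mem_disc _ _ _).1 h2).2

theorem conn_card {V : Type*} [Fintype V] [DecidableEq V] (G : SimpleGraph V) :
    ((connSets G).card : ℤ) = 2 ^ (Fintype.card V) - 1 - (disc G Finset.univ).card := by
  have h := card_pow_erase (Finset.univ : Finset V)
  rw [(conn_eq G).1, Finset.card_union_of_disjoint (conn_eq G).2, Finset.card_univ] at h
  push_cast at h
  linarith

theorem conn_sum {V : Type*} [Fintype V] [DecidableEq V] (G : SimpleGraph V) :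
    2 * (∑ S ∈ connSets G, (S.card : ℤ)) = Fintype.card V * (connSets G).card + Fintype.card V -
      ∑ S ∈ disc G Finset.univ, (2 * (S.card : ℤ) - Fintype.card V) := by
  have h := sum_pow_erase (Finset.univ : Finset V)
  rw [(conn_eq G).1, Finset.sum_union (conn_eq G).2, Finset.card_univ] at h
  rw [Finset.sum_sub_distrib, Finset.sum_const, ← Finset.mul_sum, nsmul_eq_mul] at h
  linarith

theorem mean_eq {V : Type*} [Fintype V] [DecidableEq V] (G : SimpleGraph V)
    (h0 : 0 < (connSets G).card) :
    globalMean G = Fintype.card V / 2 + ((Fintype.card V : ℝ) -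
      ((∑ S ∈ disc G Finset.univ, (2 * (S.card : ℤ) - Fintype.card V) : ℤ) : ℝ)) /
        (2 * (connSets G).card) := by
  have h := conn_sum G
  have h' : 2 * (∑ S ∈ connSets G, (S.card : ℝ)) = Fintype.card V * (connSets G).card +
      Fintype.card V -
      ((∑ S ∈ disc G Finset.univ, (2 * (S.card : ℤ) - Fintype.card V) : ℤ) : ℝ) := by
    exact_mod_cast h
  have h1 : ((connSets G).card : ℝ) ≠ 0 := by positivity
  unfold globalMean
  field_simp
  linarith

def IsSk {V : Type*} (G : SimpleGraph V) : Prop :=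
  ∃ v u : V, v ≠ u ∧ ∀ x y, G.Adj x y ↔ x ≠ y ∧ (x = v ∨ y = v ∨ (x ≠ u ∧ y ≠ u))

theorem isSk_skillet (n : ℕ) (hn : 3 ≤ n) : IsSk (skillet n) := by
  refine ⟨⟨0, by omega⟩, ⟨1, by omega⟩, by simp, ?_⟩
  intro x y
  simp only [skillet, SimpleGraph.fromRel_adj, Fin.ext_iff, ne_eq]
  omega

theorem IsSk.iso {V W : Type*} {G : SimpleGraph V} {H : SimpleGraph W} (h : IsSk H)
    (e : G ≃g H) : IsSk G := by
  obtain ⟨v, u, hvu, h⟩ := h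
  refine ⟨e.symm v, e.symm u, fun hh => hvu (e.symm.injective hh), fun x y => ?_⟩
  have h1 : ∀ a b, a = e.symm b ↔ e a = b := fun a b => by
    constructor
    · rintro rfl; simp
    · rintro rfl; simp
  rw [← e.map_adj_iff, h]
  simp only [ne_eq, h1, e.injective.eq_iff]

theorem IsSk.nonempty_iso {V W : Type*} [Fintype V] [Fintype W] {G : SimpleGraph V}
    {H : SimpleGraph W} (hG : IsSk G) (hH : IsSk H) (hc : Fintype.card V = Fintype.card W) :
    Nonempty (G ≃g H) := by
  classical
  obtain ⟨v, u, hvu, h⟩ := hG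
  obtain ⟨v', u', hvu', h'⟩ := hH
  let e0 := Fintype.equivOfCardEq hc
  let e1 : V ≃ W := e0.trans (Equiv.swap (e0 v) v')
  have e1v : e1 v = v' := by simp [e1]
  let e2 : V ≃ W := e1.trans (Equiv.swap (e1 u) u')
  have e2u : e2 u = u' := by simp [e2]
  have e2v : e2 v = v' := by
    simp only [e2, Equiv.trans_apply, e1v]
    apply Equiv.swap_apply_of_ne_of_ne _ hvu'
    rw [← e1v]
    exact fun hh => hvu (e1.injective hh)
  refine ⟨⟨e2, ?_⟩⟩
  intro x y
  rw [h, h', ← e2u, ← e2v]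
  simp only [ne_eq, e2.injective.eq_iff]

theorem disc_empty_of_clique {V : Type*} [DecidableEq V] {G : SimpleGraph V} {X : Finset V}
    (h : ∀ x ∈ X, ∀ y ∈ X, x ≠ y → G.Adj x y) : disc G X = ∅ := by
  ext S
  simp only [mem_disc, Finset.notMem_empty, iff_false]
  rintro ⟨h1, P, Q, ⟨p, hp⟩, ⟨q, hq⟩, hd, rfl, hPQ⟩
  exact hPQ p hp q hq (h p (h1 (by simp [hp])) q (h1 (by simp [hq]))
    (fun e => Finset.disjoint_left.1 hd hp (e ▸ hq)))

theorem clique_of_disc_empty {V : Type*} [DecidableEq V] {G : SimpleGraph V} {X : Finset V}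
    (h : disc G X = ∅) : ∀ x ∈ X, ∀ y ∈ X, x ≠ y → G.Adj x y := by
  intro x hx y hy hxy
  by_contra ha
  have : ({x, y} : Finset V) ∈ disc G X := by
    rw [mem_disc]
    refine ⟨by grind, {x}, {y}, by simp, by simp, by simpa using hxy, by ext; simp, by simp [ha]⟩
  rw [h] at this
  simp at this

theorem IsSk.mean {V : Type*} [Fintype V] {G : SimpleGraph V} (h : IsSk G)
    (n : ℕ) (hn : Fintype.card V = n + 3) :
    globalMean G = ((n : ℝ) + 3) / 2 + 1 / (3 * 2 ^ (n + 1)) := by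
  classical
  obtain ⟨v, u, hvu, h⟩ := h
  have D : Dec G v {u} ((Finset.univ.erase v).erase u) := by
    refine ⟨by simp, ?_, by simp, ?_, ?_, ?_⟩
    · apply Finset.card_pos.1
      rw [Finset.card_erase_of_mem (by simp [hvu.symm]), Finset.card_erase_of_mem (by simp),
        Finset.card_univ]
      omega
    · ext x
      simp only [Finset.mem_union, Finset.mem_singleton, Finset.mem_erase, Finset.mem_univ]
      grind
    · intro x hx y hy
      rw [h]
      simp only [Finset.mem_singleton, Finset.mem_erase] at hx hy
      grind
    · intro x hx
      rw [h]
      exact ⟨hx.symm, Or.inl rfl⟩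
  have hc := D.card
  have d1 : disc G {u} = ∅ := disc_single G u
  have d2 : disc G ((Finset.univ.erase v).erase u) = ∅ := by
    apply disc_empty_of_clique
    intro x hx y hy hxy
    rw [h]
    simp only [Finset.mem_erase] at hx hy
    grind
  have hs := D.s
  have hd := D.d
  have hN := conn_card G
  have hY : ((Finset.univ.erase v).erase u).card = n + 1 := by
    rw [hn, Finset.card_singleton] at hc; omega
  rw [d1, d2, hY, Finset.card_singleton] at hs hd
  simp only [Finset.sum_empty, Finset.card_empty] at hs hd
  rw [hd, hn] at hN
  have hN' : ((connSets G).card : ℤ) = 3 * 2 ^ (n + 1) := by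
    rw [hN]; push_cast; ring
  have hN2 : (connSets G).card = 3 * 2 ^ (n + 1) := by exact_mod_cast hN'
  rw [mean_eq G (by rw [hN2]; positivity), hs, hN2, hn]
  push_cast
  field_simp
  ring

end Sk

theorem stmt_16 {V : Type*} [Fintype V] (G : SimpleGraph V) (n : ℕ) (hn : 3 ≤ n)
    (hcard : Fintype.card V = n) (hcog : IsCograph G) (hconn : G.Connected)
    (hcut : ∃ v : V, ¬ (G.induce ({v}ᶜ : Set V)).Connected) :
    globalMean G ≥ globalMean (skillet n) ∧
      (globalMean G = globalMean (skillet n) ↔ Nonempty (G ≃g skillet n)) := by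
  classical
  have hp := Sk.p4free_of_cograph hcog
  obtain ⟨v, hv⟩ := hcut
  have hsk := Sk.isSk_skillet n hn
  obtain ⟨m, rfl⟩ : ∃ m, n = m + 3 := ⟨n - 3, by omega⟩
  have hmean := hsk.mean m (by simp)
  -- the cut vertex gives a split
  have hUc : (Finset.univ.erase v).card = m + 2 := by
    rw [Finset.card_erase_of_mem (by simp), Finset.card_univ, hcard]; rfl
  have hsp : Sk.Split G (Finset.univ.erase v) := by
    by_contra hns
    have := (Sk.connected_iff G _ (Finset.card_pos.1 (by omega))).2 hns
    apply hv
    have e : ((Finset.univ.erase v : Finset V) : Set V) = {v}ᶜ := by ext; simp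
    rwa [e] at this
  have hns : ¬ Sk.Split G Finset.univ := by
    have hne : (Finset.univ : Finset V).Nonempty := ⟨v, by simp⟩
    rw [← Sk.connected_iff G _ hne, Finset.coe_univ]
    exact (SimpleGraph.induceUnivIso G).connected_iff.2 hconn
  have hdom : ∀ x, x ≠ v → G.Adj v x := by
    have aux : ∀ X Y : Finset V, Y.Nonempty → X ∪ Y = Finset.univ → Disjoint X Y →
        (∀ x ∈ X, ∀ y ∈ Y, G.Adj x y) → v ∈ X → ∀ x, x ≠ v → G.Adj v x := by
      intro X Y ⟨y, hy⟩ hU hd hj hvX x hx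
      have hd' := Finset.disjoint_left.1 hd
      have hxU : x ∈ X ∪ Y := by rw [hU]; simp
      rcases Finset.mem_union.1 hxU with hxX | hxY
      · exact (Sk.join_split hsp hj (by rw [hU]; simp) (x := x) (y := y) (by simp [hx])
          (by simp; rintro rfl; exact hd' hvX hy) hxX hy).elim
      · exact hj v hvX x hxY
    rcases Sk.seinsche hp Finset.univ (by rw [Finset.card_univ]; omega) with h | h
    · exact (hns h).elim
    · obtain ⟨X, Y, hX, hY, hd, hU, hn'⟩ := h
      have hj : ∀ x ∈ X, ∀ y ∈ Y, G.Adj x y := by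
        intro x hx y hy
        have hne : x ≠ y := fun e => Finset.disjoint_left.1 hd hx (e ▸ hy)
        have := hn' x hx y hy
        rw [SimpleGraph.compl_adj] at this
        tauto
      have hvU : v ∈ X ∪ Y := by rw [hU]; simp
      rcases Finset.mem_union.1 hvU with hvX | hvY
      · exact aux X Y hY hU hd hj hvX
      · exact aux Y X hX (by rw [Finset.union_comm, hU]) hd.symm
          (fun x hx y hy => (hj y hy x hx).symm) hvY
  obtain ⟨X, Y, hX, hY, hd, hU, hn'⟩ := hsp
  have D : Sk.Dec G v X Y := ⟨hX, hY, hd, hU, hn', hdom⟩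
  have hs := D.s_le hp
  have hdc := D.d
  have hN := Sk.conn_card G
  have hc := D.card
  have hN0 : 0 < (connSets G).card := by
    apply Finset.card_pos.2
    refine ⟨{v}, ?_⟩
    simp only [connSets, Set.Finite.mem_toFinset, Set.mem_setOf_eq]
    refine ⟨by simp, (Sk.connected_iff G _ (by simp)).2 fun h => ?_⟩
    have := h.two_le
    simp at this
  have hGm := Sk.mean_eq G hN0
  -- sizes
  obtain ⟨a, ha⟩ : ∃ a, X.card = a + 1 := ⟨X.card - 1, by have := hX.card_pos; omega⟩
  obtain ⟨b, hb⟩ : ∃ b, Y.card = b + 1 := ⟨Y.card - 1, by have := hY.card_pos; omega⟩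
  have hab : m = a + b := by omega
  rw [hdc, hcard, ha, hb, hab] at hN
  have hN' : ((connSets G).card : ℤ) = 3 * 2 ^ (m + 1) - ((Sk.disc G X).card + (Sk.disc G Y).card
      + 2 * ((2 ^ a - 1) * (2 ^ b - 1))) := by
    rw [hN, hab]; ring
  have pa : (1 : ℤ) ≤ 2 ^ a := one_le_pow₀ (by norm_num)
  have pb : (1 : ℤ) ≤ 2 ^ b := one_le_pow₀ (by norm_num)
  have pab : (0 : ℤ) ≤ (2 ^ a - 1) * (2 ^ b - 1) := mul_nonneg (by linarith) (by linarith)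
  have hNle : ((connSets G).card : ℤ) ≤ 3 * 2 ^ (m + 1) := by
    rw [hN']; linarith [Int.natCast_nonneg (Sk.disc G X).card, Int.natCast_nonneg (Sk.disc G Y).card]
  have hNleR : ((connSets G).card : ℝ) ≤ 3 * 2 ^ (m + 1) := by exact_mod_cast hNle
  have hNpos : (0 : ℝ) < (connSets G).card := by exact_mod_cast hN0
  set s : ℤ := ∑ S ∈ Sk.disc G Finset.univ, (2 * (S.card : ℤ) - Fintype.card V) with hsdef
  have hsR : (2 : ℝ) ≤ (Fintype.card V : ℝ) - s := by
    have : (s : ℝ) ≤ Fintype.card V - 2 := by exact_mod_cast hs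
    linarith
  have hlow : ((m : ℝ) + 3) / 2 + 1 / (connSets G).card ≤ globalMean G := by
    rw [hGm, hcard]
    push_cast
    rw [hcard] at hsR
    push_cast at hsR
    have : (1 : ℝ) / (connSets G).card = 2 / (2 * (connSets G).card) := by field_simp
    rw [this]
    gcongr
  refine ⟨?_, ?_, ?_⟩
  · rw [hmean]
    refine le_trans ?_ hlow
    gcongr
  · intro heq
    rw [heq, hmean] at hlow
    have h1 : (1 : ℝ) / (connSets G).card ≤ 1 / (3 * 2 ^ (m + 1)) := by linarith
    rw [one_div_le_one_div hNpos (by positivity)] at h1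
    have h2 : (3 * 2 ^ (m + 1) : ℤ) ≤ (connSets G).card := by exact_mod_cast h1
    have z1 : (Sk.disc G X).card = 0 := by
      have := Int.natCast_nonneg (Sk.disc G Y).card
      have : ((Sk.disc G X).card : ℤ) ≤ 0 := by linarith
      exact_mod_cast le_antisymm this (Int.natCast_nonneg _)
    have z2 : (Sk.disc G Y).card = 0 := by
      have := Int.natCast_nonneg (Sk.disc G X).card
      have : ((Sk.disc G Y).card : ℤ) ≤ 0 := by linarith
      exact_mod_cast le_antisymm this (Int.natCast_nonneg _)
    have z3 : ((2 : ℤ) ^ a - 1) * (2 ^ b - 1) = 0 := by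
      rw [z1, z2] at hN'
      push_cast at hN'
      linarith
    have c1 := Sk.clique_of_disc_empty (Finset.card_eq_zero.1 z1)
    have c2 := Sk.clique_of_disc_empty (Finset.card_eq_zero.1 z2)
    have zz : ∀ k : ℕ, (2 : ℤ) ^ k - 1 = 0 → k = 0 := by
      intro k hk
      have := Sk.two_pow_ge k
      omega
    have fin : ∀ X Y : Finset V, X.card = 1 → Disjoint X Y → X ∪ Y = Finset.univ.erase v →
        (∀ x ∈ X, ∀ y ∈ Y, ¬ G.Adj x y) → (∀ x ∈ Y, ∀ y ∈ Y, x ≠ y → G.Adj x y) →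
        Sk.IsSk G := by
      intro X Y hX1 hd hU hn c
      obtain ⟨u, rfl⟩ := Finset.card_eq_one.1 hX1
      have hm : ∀ x, (x = u ∨ x ∈ Y) ↔ x ≠ v := by
        intro x
        have := Finset.ext_iff.1 hU x
        simpa using this
      have hu : u ≠ v := (hm u).1 (Or.inl rfl)
      refine ⟨v, u, hu.symm, fun x y => ?_⟩
      have hxY := hm x
      have hyY := hm y
      have huY : u ∉ Y := by simpa using hd
      have n1 := hn u (by simp)
      by_cases hxy : x = y
      · subst hxy; simp
      by_cases hxv : x = v
      · subst hxv; simp [hdom y (Ne.symm hxy), hxy]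
      by_cases hyv : y = v
      · subst hyv; simp [(hdom x hxy).symm, hxy]
      by_cases hxu : x = u
      · subst hxu
        simp only [hxv, hyv, ne_eq, not_true_eq_false, false_and, or_false, and_false, iff_false]
        exact n1 y (by grind)
      by_cases hyu : y = u
      · subst hyu
        simp only [hxv, hyv, ne_eq, not_true_eq_false, or_false, and_false, iff_false]
        exact fun hh => n1 x (by grind) hh.symm
      · have := c x (by grind) y (by grind) hxy
        simp [this, hxy, hxu, hyu]
    have hG : Sk.IsSk G := by
      rcases mul_eq_zero.1 z3 with h | h
      · exact fin X Y (by rw [ha, zz a h]) hd hU hn' c2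
      · exact fin Y X (by rw [hb, zz b h]) hd.symm (by rw [Finset.union_comm, hU])
          (fun x hx y hy hh => hn' y hy x hx hh.symm) c1
    exact hG.nonempty_iso hsk (by rw [hcard]; simp)
  · rintro ⟨e⟩
    rw [hmean, (hsk.iso e).mean m hcard]
end

section
/- Let G be a connected cograph of order n ≥ 4 with no cut vertex (i.e., G is 2-connected). Then there exists a vertex v of G such that the number of nonempty vertex subsets of G − v inducing a connected subgraph is strictly less than the number of vertex subsets of G that contain v and induce a connected subgraph. -/
open SimpleGraph Finset

lemma aux_P4 {V : Type*} {G : SimpleGraph V} (hcog : IsCograph G) {a b c d : V}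
    (hab : G.Adj a b) (hbc : G.Adj b c) (hcd : G.Adj c d)
    (hac : ¬ G.Adj a c) (hbd : ¬ G.Adj b d) (had : ¬ G.Adj a d) : False := by
  have n1 := hab.ne
  have n2 := hbc.ne
  have n3 := hcd.ne
  have n4 : a ≠ c := by rintro rfl; exact had hcd
  have n5 : b ≠ d := by rintro rfl; exact had hab
  have n6 : a ≠ d := by rintro rfl; exact hac hcd.symm
  refine hcog.false ⟨⟨![a, b, c, d], ?_⟩, ?_⟩
  · intro i j
    fin_cases i <;> fin_cases j <;> simp [n1, n2, n3, n4, n5, n6, n1.symm, n2.symm, n3.symm, n4.symm, n5.symm, n6.symm]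
  · intro i j
    change G.Adj (![a, b, c, d] i) (![a, b, c, d] j) ↔ _
    have hca : ¬ G.Adj c a := fun h => hac h.symm
    have hdb : ¬ G.Adj d b := fun h => hbd h.symm
    have hda : ¬ G.Adj d a := fun h => had h.symm
    fin_cases i <;> fin_cases j <;>
      simp [SimpleGraph.pathGraph_adj, hab, hbc, hcd, hac, hbd, had, hab.symm, hbc.symm, hcd.symm, hca, hdb, hda]

lemma aux_edge {V : Type*} [Fintype V] {G : SimpleGraph V} (hcog : IsCograph G)
    (hconn : G.Connected) (h2 : 2 ≤ Fintype.card V) :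
    ∃ v b, G.Adj v b ∧ ∀ x, G.Adj v x ∨ G.Adj b x := by
  classical
  haveI : Nontrivial V := Fintype.one_lt_card_iff_nontrivial.mp h2
  obtain ⟨v0⟩ := hconn.nonempty
  obtain ⟨b0, h0⟩ := hconn.preconnected.exists_adj_of_nontrivial v0
  let f : V × V → ℕ := fun p => (univ.filter fun x => G.Adj p.1 x ∨ G.Adj p.2 x).card
  obtain ⟨⟨v, b⟩, hp, hmax⟩ := Finset.exists_max_image
    (univ.filter fun p : V × V => G.Adj p.1 p.2) f ⟨(v0, b0), by simpa using h0⟩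
  have hvb : G.Adj v b := by simpa using hp
  refine ⟨v, b, hvb, ?_⟩
  by_contra! hne
  obtain ⟨w0, hw0⟩ := hne
  obtain ⟨p⟩ := hconn.preconnected v w0
  obtain ⟨d, -, hd1, hd2⟩ := p.exists_boundary_dart {x | G.Adj v x ∨ G.Adj b x}
    (Or.inr hvb.symm) (by simpa using hw0)
  have hxw : G.Adj d.fst d.snd := d.adj
  generalize d.fst = x at *
  generalize d.snd = w at *
  simp only [Set.mem_setOf_eq, not_or] at hd1 hd2
  have key : ∀ y, G.Adj v y ∨ G.Adj b y → G.Adj y w → G.Adj v y ∧ G.Adj b y := by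
    intro y hy hyw
    by_contra hcon
    rcases hy with hy | hy
    · exact aux_P4 hcog hyw.symm hy.symm hvb (fun h => hd2.1 h.symm)
        (fun h => hcon ⟨hy, h.symm⟩) (fun h => hd2.2 h.symm)
    · exact aux_P4 hcog hyw.symm hy.symm hvb.symm (fun h => hd2.2 h.symm)
        (fun h => hcon ⟨h.symm, hy⟩) (fun h => hd2.1 h.symm)
  obtain ⟨hvx, hbx⟩ := key x hd1 hxw
  have hlt : f (v, b) < f (v, x) := by
    apply Finset.card_lt_card
    refine Finset.ssubset_iff_subset_ne.mpr ⟨?_, ?_⟩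
    · intro y hy
      simp only [mem_filter, mem_univ, true_and] at hy ⊢
      by_contra! hcon
      have hby : G.Adj b y := hy.resolve_left hcon.1
      refine aux_P4 hcog hxw.symm hbx.symm hby (fun h => hd2.2 h.symm) hcon.2 ?_
      intro h
      exact hcon.1 (key y hy h.symm).1
    · intro h
      have : w ∈ univ.filter fun y => G.Adj v y ∨ G.Adj x y := by simp [hxw]
      rw [← h] at this
      simp [hd2] at this
  exact absurd (hmax (v, x) (by simpa using hvx)) (not_le.mpr hlt)

lemma aux_star {V : Type*} {G : SimpleGraph V} {T : Set V} {v : V} (hv : v ∈ T)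
    (h : ∀ t ∈ T, t ≠ v → G.Adj v t) : (G.induce T).Connected := by
  refine (SimpleGraph.connected_iff_exists_forall_reachable _).mpr ⟨⟨v, hv⟩, ?_⟩
  rintro ⟨t, ht⟩
  by_cases e : t = v
  · subst e; exact Reachable.refl _
  · exact Adj.reachable (by simpa using h t ht e)

lemma aux_insert {V : Type*} {G : SimpleGraph V} {S : Set V} {v x : V} (hx : x ∈ S)
    (hS : (G.induce S).Connected) (h : G.Adj v x) : (G.induce (insert v S)).Connected := by
  refine (SimpleGraph.connected_iff_exists_forall_reachable _).mpr
    ⟨⟨x, Set.mem_insert_of_mem _ hx⟩, ?_⟩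
  rintro ⟨t, rfl | ht⟩
  · exact Adj.reachable (by simpa using h.symm)
  · exact (hS.preconnected ⟨x, hx⟩ ⟨t, ht⟩).map
      (SimpleGraph.induceHomOfLE G (Set.subset_insert v S)).toHom

lemma aux_disc {V : Type*} {G : SimpleGraph V} {S : Set V} {b w : V} (hb : b ∈ S)
    (hw : w ∈ S) (hne : b ≠ w) (h : ∀ t ∈ S, ¬ G.Adj b t) : ¬ (G.induce S).Connected := by
  intro hc
  haveI : Nontrivial S := ⟨⟨b, hb⟩, ⟨w, hw⟩, by simpa using hne⟩
  obtain ⟨⟨t, ht⟩, h'⟩ := hc.preconnected.exists_adj_of_nontrivial ⟨b, hb⟩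
  exact h t ht (by simpa using h')

lemma aux_main {V : Type*} [Fintype V] [DecidableEq V] (G : SimpleGraph V) [DecidableRel G.Adj]
    {v b : V} (hvb : G.Adj v b)
    (hdom : ∀ x, G.Adj v x ∨ G.Adj b x)
    (hdeg : (univ.filter fun x => x ≠ v ∧ ¬ G.Adj v x).card ≤
      (univ.filter fun x => x ≠ b ∧ ¬ G.Adj b x).card) :
    ((Set.toFinite {S : Finset V | S.Nonempty ∧ v ∉ S ∧
          (G.induce (S : Set V)).Connected}).toFinset).card <
        (localSets G v).card := by
  set F := (Set.toFinite {S : Finset V | S.Nonempty ∧ v ∉ S ∧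
          (G.induce (S : Set V)).Connected}).toFinset with hF
  set P := univ.filter fun x => x ≠ v ∧ ¬ G.Adj v x with hP
  set Q := univ.filter fun x => x ≠ b ∧ ¬ G.Adj b x with hQ
  have hQv : ∀ x ∈ Q, G.Adj v x := by
    intro x hx
    simp only [hQ, mem_filter] at hx
    exact (hdom x).resolve_right hx.2.2
  let F1 := F.filter fun S => ∃ x ∈ S, G.Adj v x
  have hFc : F.card = F1.card + (F.filter fun S => ¬ ∃ x ∈ S, G.Adj v x).card :=
    (Finset.card_filter_add_card_filter_not _).symm
  have h2 : (F.filter fun S => ¬ ∃ x ∈ S, G.Adj v x).card ≤ (P.powerset.erase ∅).card := by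
    apply Finset.card_le_card
    intro S hS
    simp only [hF, mem_filter, Set.Finite.mem_toFinset, Set.mem_setOf_eq] at hS
    obtain ⟨⟨hn, hv, -⟩, hx⟩ := hS
    simp only [mem_erase, mem_powerset]
    refine ⟨hn.ne_empty, fun x hxS => ?_⟩
    simp only [hP, mem_filter, mem_univ, true_and]
    exact ⟨fun h => hv (h ▸ hxS), fun h => hx ⟨x, hxS, h⟩⟩
  have h3 : (P.powerset.erase ∅).card ≤ (Q.powerset.erase ∅).card := by
    rw [card_erase_of_mem (by simp), card_erase_of_mem (by simp), card_powerset, card_powerset]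
    have := Nat.pow_le_pow_right (n := 2) (by norm_num) hdeg
    omega
  let E := F1 ∪ (Q.powerset.erase ∅).image (insert b)
  have hvF : ∀ S ∈ F1, v ∉ S ∧ S.Nonempty ∧ (G.induce (S : Set V)).Connected ∧
      ∃ x ∈ S, G.Adj v x := by
    intro S hS
    simp only [F1, hF, mem_filter, Set.Finite.mem_toFinset, Set.mem_setOf_eq] at hS
    tauto
  have hbQ : b ∉ Q := by simp [hQ]
  have hvQ : v ∉ Q := by simp [hQ, hvb.symm]
  have hEcard : E.card = F1.card + (Q.powerset.erase ∅).card := by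
    rw [Finset.card_union_of_disjoint, Finset.card_image_of_injOn]
    · intro X hX Y hY hXY
      have hX' : b ∉ X := fun h => hbQ ((by simpa using hX : X ⊆ Q ∧ X ≠ ∅).1 h)
      have hY' : b ∉ Y := fun h => hbQ ((by simpa using hY : Y ⊆ Q ∧ Y ≠ ∅).1 h)
      have : (insert b X).erase b = (insert b Y).erase b := by simpa using congrArg (·.erase b) hXY
      rwa [erase_insert hX', erase_insert hY'] at this
    · rw [Finset.disjoint_left]
      intro S hS hS'
      simp only [mem_image, mem_erase, mem_powerset] at hS'
      obtain ⟨W, ⟨hW, hWQ⟩, rfl⟩ := hS'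
      obtain ⟨w, hw⟩ := Finset.nonempty_iff_ne_empty.mpr hW
      refine aux_disc (b := b) (w := w) (by simp) (by simp [hw]) ?_ ?_ (hvF _ hS).2.2.1
      · rintro rfl; exact hbQ (hWQ hw)
      · intro t ht
        simp only [coe_insert, Set.mem_insert_iff, mem_coe] at ht
        rcases ht with rfl | ht
        · exact G.loopless.irrefl _
        · have := hWQ ht
          simp only [hQ, mem_filter] at this
          exact this.2.2
  have hEv : ∀ S ∈ E, v ∉ S ∧ S.Nonempty ∧ (G.induce ((insert v S : Finset V) : Set V)).Connected := by
    intro S hS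
    rcases Finset.mem_union.mp hS with hS | hS
    · obtain ⟨h1, h2, h3, x, hx, hvx⟩ := hvF S hS
      refine ⟨h1, h2, ?_⟩
      rw [coe_insert]
      exact aux_insert (by simpa using hx) h3 hvx
    · simp only [mem_image, mem_erase, mem_powerset] at hS
      obtain ⟨W, ⟨hW, hWQ⟩, rfl⟩ := hS
      refine ⟨?_, ⟨b, by simp⟩, ?_⟩
      · simp only [mem_insert, not_or]
        exact ⟨hvb.ne, fun h => hvQ (hWQ h)⟩
      · refine aux_star (v := v) (by simp) ?_
        intro t ht htv
        simp only [coe_insert, Set.mem_insert_iff, mem_coe] at ht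
        rcases ht with rfl | rfl | ht
        · exact absurd rfl htv
        · exact hvb
        · exact hQv t (hWQ ht)
  have hfin : ((insert ∅ E).image (insert v)).card ≤ (localSets G v).card := by
    apply Finset.card_le_card
    intro T hT
    simp only [mem_image, mem_insert] at hT
    obtain ⟨S, hS, rfl⟩ := hT
    simp only [localSets, Set.Finite.mem_toFinset, Set.mem_setOf_eq]
    refine ⟨by simp, ?_⟩
    rcases hS with rfl | hS
    · exact aux_star (v := v) (by simp) (by intro t ht h; simp at ht; exact absurd ht h)
    · exact (hEv S hS).2.2
  rw [Finset.card_image_of_injOn, card_insert_of_notMem] at hfin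
  · omega
  · intro h; exact Finset.not_nonempty_empty (hEv ∅ h).2.1
  · have hno : ∀ S ∈ insert ∅ E, v ∉ S := by
      intro S hS
      rcases Finset.mem_insert.mp hS with rfl | hS
      · simp
      · exact (hEv S hS).1
    intro X hX Y hY hXY
    have : (insert v X).erase v = (insert v Y).erase v := by simpa using congrArg (·.erase v) hXY
    rwa [erase_insert (hno X hX), erase_insert (hno Y hY)] at this

theorem stmt_17 {V : Type*} [Fintype V] (G : SimpleGraph V) (n : ℕ) (hn : 4 ≤ n)
    (hcard : Fintype.card V = n) (hcog : IsCograph G) (hconn : G.Connected)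
    (hnocut : ∀ v : V, (G.induce ({v}ᶜ : Set V)).Connected) :
    ∃ v : V,
      ((Set.toFinite {S : Finset V | S.Nonempty ∧ v ∉ S ∧
          (G.induce (S : Set V)).Connected}).toFinset).card <
        (localSets G v).card := by
  classical
  obtain ⟨v, b, hvb, hdom⟩ := aux_edge hcog hconn (by omega)
  rcases le_total (univ.filter fun x => x ≠ v ∧ ¬ G.Adj v x).card
      (univ.filter fun x => x ≠ b ∧ ¬ G.Adj b x).card with h | h
  · exact ⟨v, aux_main G hvb hdom h⟩
  · exact ⟨b, aux_main G hvb.symm (fun x => (hdom x).symm) h⟩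
end

section
/- Let G_1 be a connected cograph of order n_1 ≥ 2 and let G_2 be a cograph (not necessarily connected) of order n_2 with n_2 < n_1. Then M_{G_1} > M_{G_2}. -/
open SimpleGraph Finset

section helpers
open Classical

lemma sum_split {V : Type*} (A B U : Finset V) (hd : Disjoint A B) (hU : A ∪ B = U)
    (h : Finset V → ℤ) (h0 : ∀ S, S ⊆ U → ¬ S ⊆ A → ¬ S ⊆ B → h S = 0) :
    ∑ S ∈ U.powerset, h S = ∑ S ∈ A.powerset, h S + ∑ S ∈ B.powerset, h S - h ∅ := by
  have h1 : ∑ S ∈ A.powerset ∪ B.powerset, h S = ∑ S ∈ U.powerset, h S := by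
    apply Finset.sum_subset
    · intro S hS
      simp only [Finset.mem_union, Finset.mem_powerset] at hS ⊢
      rw [← hU]
      rcases hS with hS | hS
      · exact hS.trans Finset.subset_union_left
      · exact hS.trans Finset.subset_union_right
    · intro S hS hn
      simp only [Finset.mem_union, Finset.mem_powerset, not_or] at hS hn
      exact h0 S hS hn.1 hn.2
  have h2 := Finset.sum_union_inter (s₁ := A.powerset) (s₂ := B.powerset) (f := h)
  have h3 : A.powerset ∩ B.powerset = {∅} := by
    ext S
    simp only [Finset.mem_inter, Finset.mem_powerset, Finset.mem_singleton]
    constructor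
    · rintro ⟨ha, hb⟩
      have := hd ha hb
      simpa using this
    · rintro rfl; simp
  rw [h3, Finset.sum_singleton, h1] at h2
  linarith

lemma sum_full {V : Type*} (U : Finset V) (c : ℤ) :
    ∑ S ∈ U.powerset, (2 * (S.card : ℤ) - c) = (U.card - c) * 2 ^ U.card := by
  induction U using Finset.induction_on generalizing c with
  | empty => simp
  | insert a s ha ih =>
    rw [Finset.sum_powerset_insert ha]
    have : ∑ t ∈ s.powerset, (2 * ((insert a t).card : ℤ) - c)
        = ∑ t ∈ s.powerset, (2 * (t.card : ℤ) - (c - 2)) := by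
      apply Finset.sum_congr rfl
      intro t ht
      have : a ∉ t := fun h => ha (Finset.mem_powerset.1 ht h)
      rw [Finset.card_insert_of_notMem this]; push_cast; ring
    rw [this, ih, ih, Finset.card_insert_of_notMem ha, pow_succ]; push_cast; ring

noncomputable def TT {V : Type*} (P : Finset V → Prop) (U : Finset V) (c : ℤ) : ℤ :=
  ∑ S ∈ U.powerset, if P S then 2 * (S.card : ℤ) - c else 0

def Str {V : Type*} (P : Finset V → Prop) : Prop :=
  (∀ S, P S → 2 ≤ S.card) ∧ ∀ U : Finset V, 2 ≤ U.card → ∃ A B : Finset V,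
    A.Nonempty ∧ B.Nonempty ∧ Disjoint A B ∧ A ∪ B = U ∧
    ((∀ S, S ⊆ U → ¬ S ⊆ A → ¬ S ⊆ B → P S) ∨ (∀ S, S ⊆ U → ¬ S ⊆ A → ¬ S ⊆ B → ¬ P S))

lemma TT_mono {V : Type*} (P : Finset V → Prop) (U : Finset V) {c d : ℤ} (h : c ≤ d) :
    TT P U d ≤ TT P U c := by
  apply Finset.sum_le_sum
  intro S _
  split_ifs <;> linarith

lemma TT_small {V : Type*} {P : Finset V → Prop} (hP : ∀ S, P S → 2 ≤ S.card) (U : Finset V)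
    (hU : U.card < 2) (c : ℤ) : TT P U c = 0 := by
  apply Finset.sum_eq_zero
  intro S hS
  have := Finset.card_le_card (Finset.mem_powerset.1 hS)
  rw [if_neg]
  intro h
  have := hP S h
  omega

lemma TT_join {V : Type*} {P : Finset V → Prop} (hP : ∀ S, P S → 2 ≤ S.card)
    (A B U : Finset V) (hd : Disjoint A B) (hU : A ∪ B = U)
    (h : ∀ S, S ⊆ U → ¬ S ⊆ A → ¬ S ⊆ B → ¬ P S) (c : ℤ) :
    TT P U c = TT P A c + TT P B c := by
  have he : ¬ P ∅ := fun h => by simpa using hP _ h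
  unfold TT
  rw [sum_split A B U hd hU _ (fun S h1 h2 h3 => if_neg (h S h1 h2 h3)), if_neg he]
  ring

lemma TT_union {V : Type*} {P : Finset V → Prop} (hP : ∀ S, P S → 2 ≤ S.card)
    (A B U : Finset V) (hd : Disjoint A B) (hU : A ∪ B = U)
    (h : ∀ S, S ⊆ U → ¬ S ⊆ A → ¬ S ⊆ B → P S) (c : ℤ) :
    TT P U c = TT P A c + TT P B c + (U.card - c) * 2 ^ U.card - (A.card - c) * 2 ^ A.card
      - (B.card - c) * 2 ^ B.card - c := by
  have he : ¬ P ∅ := fun h => by simpa using hP _ h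
  have key := sum_split A B U hd hU
    (fun S => (if P S then 2 * (S.card : ℤ) - c else 0) - (2 * (S.card : ℤ) - c))
    (fun S h1 h2 h3 => by simp [h S h1 h2 h3])
  simp only [Finset.sum_sub_distrib (f := fun S => if P S then 2 * (Finset.card S : ℤ) - c else 0),
    sum_full, if_neg he, Finset.card_empty] at key
  unfold TT
  push_cast at key
  linarith

lemma pow_facts (a : ℕ) : (a : ℤ) + 1 ≤ 2 ^ a ∧ 2 * (a : ℤ) ≤ 2 ^ a := by
  induction a with
  | zero => simp
  | succ n ih =>
    rw [pow_succ]; push_cast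
    constructor <;> linarith [ih.1, ih.2]

lemma R_lem {V : Type*} {P : Finset V → Prop} (hP : Str P) (U : Finset V) :
    TT P U (U.card + 2) ≤ 0 := by
  induction U using Finset.strongInduction with
  | H U ih =>
  by_cases hc : U.card < 2
  · rw [TT_small hP.1 U hc]
  obtain ⟨A, B, hA, hB, hd, hU, h⟩ := hP.2 U (by omega)
  have hcard : U.card = A.card + B.card := by rw [← hU, Finset.card_union_of_disjoint hd]
  have ha := hA.card_pos
  have hb := hB.card_pos
  have iA := ih A (by
    refine lt_of_le_of_ne (hU ▸ Finset.subset_union_left) ?_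
    rintro rfl; omega)
  have iB := ih B (by
    refine lt_of_le_of_ne (hU ▸ Finset.subset_union_right) ?_
    rintro rfl; omega)
  have mA := TT_mono P A (c := A.card + 2) (d := U.card + 2) (by rw [hcard]; push_cast; linarith)
  have mB := TT_mono P B (c := B.card + 2) (d := U.card + 2) (by rw [hcard]; push_cast; linarith)
  rcases h with h | h
  · rw [TT_union hP.1 A B U hd hU h]
    have pa := (pow_facts A.card).1
    have pb := (pow_facts B.card).1
    rw [hcard, pow_add] at *
    push_cast at *
    nlinarith [mul_nonneg (sub_nonneg.2 pa) (by linarith : (0:ℤ) ≤ 2 ^ B.card - 1),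
      mul_nonneg (sub_nonneg.2 pb) (by linarith : (0:ℤ) ≤ 2 ^ A.card - 1)]
  · rw [TT_join hP.1 A B U hd hU h]
    linarith

lemma Q_lem {V : Type*} {P : Finset V → Prop} (hP : Str P) (U : Finset V) (hne : U.Nonempty) :
    TT P U (U.card + 1) ≤ U.card - 1 := by
  have hn := hne.card_pos
  by_cases hc : U.card < 2
  · rw [TT_small hP.1 U hc]; omega
  obtain ⟨A, B, hA, hB, hd, hU, h⟩ := hP.2 U (by omega)
  have hcard : U.card = A.card + B.card := by rw [← hU, Finset.card_union_of_disjoint hd]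
  have ha := hA.card_pos
  have hb := hB.card_pos
  have iA := R_lem hP A
  have iB := R_lem hP B
  have mA := TT_mono P A (c := A.card + 2) (d := U.card + 1) (by rw [hcard]; push_cast; linarith)
  have mB := TT_mono P B (c := B.card + 2) (d := U.card + 1) (by rw [hcard]; push_cast; linarith)
  rcases h with h | h
  · rw [TT_union hP.1 A B U hd hU h]
    have pa := (pow_facts A.card).2
    have pb := (pow_facts B.card).2
    have ha' : (1:ℤ) ≤ A.card := by exact_mod_cast ha
    have hb' : (1:ℤ) ≤ B.card := by exact_mod_cast hb
    rw [hcard, pow_add] at *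
    push_cast at *
    have := mul_le_mul (by linarith : (A.card : ℤ) - 1 ≤ 2 ^ A.card - 1 - A.card)
      (by linarith : (B.card : ℤ) - 1 ≤ 2 ^ B.card - 1 - B.card) (by linarith) (by linarith)
    nlinarith
  · rw [TT_join hP.1 A B U hd hU h]
    have : (1:ℤ) ≤ U.card := by exact_mod_cast hn
    linarith

lemma A_lem {V : Type*} {P : Finset V → Prop} (hP : Str P) (U : Finset V) (hc : 2 ≤ U.card)
    (hPU : ¬ P U) : TT P U U.card ≤ U.card - 2 := by
  obtain ⟨A, B, hA, hB, hd, hU, h⟩ := hP.2 U (by omega)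
  have hcard : U.card = A.card + B.card := by rw [← hU, Finset.card_union_of_disjoint hd]
  have ha := hA.card_pos
  have hb := hB.card_pos
  have iA := Q_lem hP A hA
  have iB := Q_lem hP B hB
  have mA := TT_mono P A (c := A.card + 1) (d := U.card) (by rw [hcard]; push_cast; linarith)
  have mB := TT_mono P B (c := B.card + 1) (d := U.card) (by rw [hcard]; push_cast; linarith)
  rcases h with h | h
  · exfalso
    refine hPU (h U subset_rfl (fun h => ?_) (fun h => ?_))
    · have := Finset.card_le_card h; omega
    · have := Finset.card_le_card h; omega
  · rw [TT_join hP.1 A B U hd hU h]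
    have : (U.card : ℤ) = A.card + B.card := by exact_mod_cast hcard
    linarith

def P4f {V : Type*} (G : SimpleGraph V) : Prop :=
  ∀ x y v z, x ≠ v → x ≠ z → y ≠ z → G.Adj x y → G.Adj y v → G.Adj v z →
    ¬ G.Adj x v → ¬ G.Adj x z → ¬ G.Adj y z → False

lemma P4f_of {V : Type*} {G : SimpleGraph V} (h : IsCograph G) : P4f G := by
  intro x y v z h1 h2 h3 a1 a2 a3 b1 b2 b3
  have e1 := a1.ne
  have e2 := a2.ne
  have e3 := a3.ne
  refine h.false ⟨⟨![x, y, v, z], ?_⟩, ?_⟩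
  · intro i j hij
    fin_cases i <;> fin_cases j <;> simp_all
  · intro i j
    change G.Adj (![x, y, v, z] i) (![x, y, v, z] j) ↔ _
    have c1 := a1.symm
    have c2 := a2.symm
    have c3 := a3.symm
    have d1 : ¬ G.Adj v x := fun e => b1 e.symm
    have d2 : ¬ G.Adj z x := fun e => b2 e.symm
    have d3 : ¬ G.Adj z y := fun e => b3 e.symm
    fin_cases i <;> fin_cases j <;>
      simp [SimpleGraph.pathGraph_adj, *]

lemma P4f_compl {V : Type*} {G : SimpleGraph V} (h : P4f G) : P4f Gᶜ := by
  intro x y v z h1 h2 h3 a1 a2 a3 b1 b2 b3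
  simp only [SimpleGraph.compl_adj, not_and, not_not] at *
  exact h y z x v a1.1.symm a2.1 a3.1.symm (b3 h3) (b2 h2).symm (b1 h1)
    (fun e => a1.2 e.symm) a2.2 (fun e => a3.2 e.symm)

def Spl {V : Type*} (G : SimpleGraph V) (U : Finset V) : Prop :=
  ∃ A B : Finset V, A.Nonempty ∧ B.Nonempty ∧ Disjoint A B ∧ A ∪ B = U ∧
    ∀ x ∈ A, ∀ y ∈ B, ¬ G.Adj x y

lemma Spl_of {V : Type*} {G : SimpleGraph V} {U A : Finset V} (hA : A.Nonempty)
    (hAU : A ⊆ U) (hne : ∃ u ∈ U, u ∉ A) (h : ∀ x ∈ A, ∀ y ∈ U, y ∉ A → ¬ G.Adj x y) :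
    Spl G U := by
  obtain ⟨u, hu, hu'⟩ := hne
  refine ⟨A, U \ A, hA, ⟨u, by simp [hu, hu']⟩, Finset.disjoint_sdiff,
    Finset.union_sdiff_of_subset hAU, ?_⟩
  intro x hx y hy
  simp only [Finset.mem_sdiff] at hy
  exact h x hx y hy.1 hy.2

lemma step_aux {V : Type*} {G : SimpleGraph V} (h : P4f G) {W A B : Finset V} {v w : V}
    (hv : v ∉ W) (hB : B.Nonempty) (hd : Disjoint A B) (hU : A ∪ B = W)
    (hAB : ∀ x ∈ A, ∀ y ∈ B, ¬ G.Adj x y) (hw : w ∈ A) (hvw : ¬ G.Adj w v) :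
    Spl G (insert v W) := by
  subst hU
  have hvA : v ∉ A := fun h => hv (Finset.mem_union_left _ h)
  have hvB : v ∉ B := fun h => hv (Finset.mem_union_right _ h)
  by_cases h1 : ∃ x ∈ A, ∃ y ∈ A, ¬ G.Adj x v ∧ G.Adj y v ∧ G.Adj x y
  · obtain ⟨x, hx, y, hy, h1, h2, h3⟩ := h1
    apply Spl_of (A := B) hB
    · intro z hz; simp [hz]
    · exact ⟨v, by simp, hvB⟩
    · intro z hz u hu huB e
      simp only [Finset.mem_insert, Finset.mem_union] at hu
      rcases hu with rfl | hu | hu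
      · exact h x y u z (fun e => hvA (e ▸ hx)) (fun e => Finset.disjoint_left.1 hd hx (e ▸ hz))
          (fun e => Finset.disjoint_left.1 hd hy (e ▸ hz)) h3 h2 e.symm h1 (hAB x hx z hz)
          (hAB y hy z hz)
      · exact hAB u hu z hz e.symm
      · exact huB hu
  · push Not at h1
    apply Spl_of (A := A.filter (fun x => ¬ G.Adj x v)) ⟨w, by simp [hw, hvw]⟩
    · intro z hz; simp at hz; simp [hz]
    · exact ⟨v, by simp, by simp [hvA]⟩
    · intro x hx u hu hun e
      simp only [Finset.mem_insert, Finset.mem_union, Finset.mem_filter, not_and, not_not] at *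
      rcases hu with rfl | hu | hu
      · exact hx.2 e
      · exact h1 x hx.1 u hu hx.2 (hun hu) e
      · exact hAB x hx.1 u hu e

lemma step_lem {V : Type*} {G : SimpleGraph V} (h : P4f G) {W : Finset V} {v : V}
    (hv : v ∉ W) (hW : W.Nonempty) (hs : Spl G W) :
    Spl G (insert v W) ∨ Spl Gᶜ (insert v W) := by
  obtain ⟨A, B, hA, hB, hd, hU, hAB⟩ := hs
  by_cases hM : ∃ w ∈ W, ¬ G.Adj w v
  · left
    obtain ⟨w, hw, hwv⟩ := hM
    rw [← hU, Finset.mem_union] at hw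
    rcases hw with hw | hw
    · exact step_aux h hv hB hd hU hAB hw hwv
    · exact step_aux h hv hA hd.symm (by rw [Finset.union_comm]; exact hU)
        (fun x hx y hy e => hAB y hy x hx e.symm) hw hwv
  · right
    push Not at hM
    obtain ⟨u, hu⟩ := hW
    refine Spl_of (A := W) ⟨u, hu⟩ (Finset.subset_insert _ _) ⟨v, by simp, hv⟩ ?_
    intro x hx y hy hyW
    have : y = v := by simpa [hyW] using hy
    subst this
    simp [hM x hx]

lemma seinsche {V : Type*} {G : SimpleGraph V} (h : P4f G) (U : Finset V) :
    2 ≤ U.card → Spl G U ∨ Spl Gᶜ U := by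
  induction U using Finset.induction_on with
  | empty => simp
  | insert v W hv ih =>
    intro hc
    rw [Finset.card_insert_of_notMem hv] at hc
    have hW : W.Nonempty := Finset.card_pos.1 (by omega)
    by_cases h2 : 2 ≤ W.card
    · rcases ih h2 with hs | hs
      · exact step_lem h hv hW hs
      · have := step_lem (P4f_compl h) hv hW hs
        rw [compl_compl] at this
        exact this.symm
    · obtain ⟨w, rfl⟩ := Finset.card_eq_one.1 (by omega : W.card = 1)
      have hvw : v ≠ w := by simpa using hv
      by_cases e : G.Adj w v
      · right
        refine Spl_of (A := {w}) hW (by simp) ⟨v, by simp, hv⟩ ?_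
        simp [hvw, e]
      · left
        refine Spl_of (A := {w}) hW (by simp) ⟨v, by simp, hv⟩ ?_
        simp [hvw, e]

lemma disc_of_split {V : Type*} {G : SimpleGraph V} {A B S : Finset V}
    (hAB : ∀ x ∈ A, ∀ y ∈ B, ¬ G.Adj x y) (hd : Disjoint A B) (hS : S ⊆ A ∪ B)
    (h1 : ¬ S ⊆ A) (h2 : ¬ S ⊆ B) : ¬ (G.induce (S : Set V)).Connected := by
  intro hc
  obtain ⟨y, hy, hyA⟩ := Finset.not_subset.1 h1
  obtain ⟨x, hx, hxB⟩ := Finset.not_subset.1 h2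
  have hxA : x ∈ A := by
    have := hS hx
    simp only [Finset.mem_union] at this; tauto
  have key : ∀ u w : (S : Set V), (G.induce (S : Set V)).Walk u w → u.1 ∈ A → w.1 ∈ A := by
    intro u w p
    induction p with
    | nil => exact id
    | cons hadj p ih =>
      rename_i a b c
      intro ha
      apply ih
      have hb := hS b.2
      simp only [Finset.mem_union] at hb
      rcases hb with hb | hb
      · exact hb
      · exact absurd hadj (hAB _ ha _ hb)
  obtain ⟨p⟩ := hc.preconnected ⟨x, hx⟩ ⟨y, hy⟩
  exact hyA (key _ _ p hxA)

lemma conn_of_split {V : Type*} {G : SimpleGraph V} {A B S : Finset V}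
    (hAB : ∀ x ∈ A, ∀ y ∈ B, ¬ Gᶜ.Adj x y) (hd : Disjoint A B) (hS : S ⊆ A ∪ B)
    (h1 : ¬ S ⊆ A) (h2 : ¬ S ⊆ B) : (G.induce (S : Set V)).Connected := by
  obtain ⟨y, hy, hyA⟩ := Finset.not_subset.1 h1
  obtain ⟨x, hx, hxB⟩ := Finset.not_subset.1 h2
  have hxA : x ∈ A := by
    have := hS hx
    simp only [Finset.mem_union] at this; tauto
  have hyB : y ∈ B := by
    have := hS hy
    simp only [Finset.mem_union] at this; tauto
  have hadj : ∀ a ∈ A, ∀ b ∈ B, G.Adj a b := by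
    intro a ha b hb
    have := hAB a ha b hb
    rw [SimpleGraph.compl_adj, not_and, not_not] at this
    exact this (fun e => Finset.disjoint_left.1 hd ha (e ▸ hb))
  have hxy : (G.induce (S : Set V)).Adj ⟨x, hx⟩ ⟨y, hy⟩ := hadj x hxA y hyB
  have key : ∀ u : (S : Set V), (G.induce (S : Set V)).Reachable ⟨x, hx⟩ u := by
    intro u
    have hu := hS u.2
    simp only [Finset.mem_union] at hu
    rcases hu with hu | hu
    · have : (G.induce (S : Set V)).Adj ⟨y, hy⟩ u := (hadj u.1 hu y hyB).symm
      exact hxy.reachable.trans this.reachable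
    · have : (G.induce (S : Set V)).Adj ⟨x, hx⟩ u := hadj x hxA u.1 hu
      exact this.reachable
  haveI : Nonempty (S : Set V) := ⟨⟨x, hx⟩⟩
  exact ⟨fun u w => (key u).symm.trans (key w)⟩

lemma conn_small {V : Type*} {G : SimpleGraph V} {S : Finset V} (hS : S.card = 1) :
    (G.induce (S : Set V)).Connected := by
  obtain ⟨a, rfl⟩ := Finset.card_eq_one.1 hS
  haveI : Nonempty (({a} : Finset V) : Set V) := ⟨⟨a, by simp⟩⟩
  refine ⟨fun u w => ?_⟩
  have : u = w := by
    apply Subtype.ext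
    have h1 := u.2
    have h2 := w.2
    simp at h1 h2
    rw [h1, h2]
  rw [this]

lemma card_mixed {V : Type*} {A B S : Finset V} (hS : S ⊆ A ∪ B)
    (h1 : ¬ S ⊆ A) (h2 : ¬ S ⊆ B) : 2 ≤ S.card := by
  obtain ⟨y, hy, hyA⟩ := Finset.not_subset.1 h1
  obtain ⟨x, hx, hxB⟩ := Finset.not_subset.1 h2
  apply Finset.one_lt_card.2
  refine ⟨x, hx, y, hy, ?_⟩
  rintro rfl
  have := hS hx
  simp only [Finset.mem_union] at this; tauto

def PD {V : Type*} (G : SimpleGraph V) (S : Finset V) : Prop :=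
  S.Nonempty ∧ ¬ (G.induce (S : Set V)).Connected

def PC {V : Type*} (G : SimpleGraph V) (S : Finset V) : Prop :=
  2 ≤ S.card ∧ (G.induce (S : Set V)).Connected

lemma str_PD {V : Type*} {G : SimpleGraph V} (h : P4f G) : Str (PD G) := by
  constructor
  · rintro S ⟨hn, hS⟩
    have := hn.card_pos
    by_contra hc
    exact hS (conn_small (by omega))
  · intro U hU
    rcases seinsche h U hU with ⟨A, B, hA, hB, hd, rfl, hs⟩ | ⟨A, B, hA, hB, hd, rfl, hs⟩
    · refine ⟨A, B, hA, hB, hd, rfl, Or.inl fun S h0 h1 h2 => ⟨?_, disc_of_split hs hd h0 h1 h2⟩⟩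
      have := card_mixed h0 h1 h2
      exact Finset.card_pos.1 (by omega)
    · exact ⟨A, B, hA, hB, hd, rfl, Or.inr fun S h0 h1 h2 hp =>
        hp.2 (conn_of_split hs hd h0 h1 h2)⟩

lemma str_PC {V : Type*} {G : SimpleGraph V} (h : P4f G) : Str (PC G) := by
  constructor
  · exact fun S hS => hS.1
  · intro U hU
    rcases seinsche h U hU with ⟨A, B, hA, hB, hd, rfl, hs⟩ | ⟨A, B, hA, hB, hd, rfl, hs⟩
    · exact ⟨A, B, hA, hB, hd, rfl, Or.inr fun S h0 h1 h2 hp =>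
        disc_of_split hs hd h0 h1 h2 hp.2⟩
    · exact ⟨A, B, hA, hB, hd, rfl, Or.inl fun S h0 h1 h2 =>
        ⟨card_mixed h0 h1 h2, conn_of_split hs hd h0 h1 h2⟩⟩

lemma mem_connSets {V : Type*} [Fintype V] (G : SimpleGraph V) (S : Finset V) :
    S ∈ connSets G ↔ S.Nonempty ∧ (G.induce (S : Set V)).Connected := by
  simp [connSets]

lemma sum_conn {V : Type*} [Fintype V] (G : SimpleGraph V) (c : ℤ) :
    ∑ S ∈ connSets G, (2 * (S.card : ℤ) - c) =
      ∑ S ∈ (Finset.univ : Finset V).powerset,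
        if S.Nonempty ∧ (G.induce (S : Set V)).Connected then 2 * (S.card : ℤ) - c else 0 := by
  rw [← Finset.sum_filter]
  apply Finset.sum_congr _ (fun _ _ => rfl)
  ext S
  simp [mem_connSets]

lemma lower {V : Type*} [Fintype V] {G : SimpleGraph V} (h : P4f G) (h2 : 2 ≤ Fintype.card V)
    (hc : G.Connected) : 0 < ∑ S ∈ connSets G, (2 * (S.card : ℤ) - Fintype.card V) := by
  have hU : ¬ PD G Finset.univ := by
    rintro ⟨-, hn⟩
    apply hn
    rw [Finset.coe_univ]
    exact (SimpleGraph.induceUnivIso G).connected_iff.2 hc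
  have key := A_lem (str_PD h) Finset.univ (by simpa using h2) hU
  have hs : ∑ S ∈ (Finset.univ : Finset V).powerset, (2 * (S.card : ℤ) - Fintype.card V) =
      ∑ S ∈ connSets G, (2 * (S.card : ℤ) - Fintype.card V) + TT (PD G) Finset.univ (Fintype.card V)
      + ∑ S ∈ (Finset.univ : Finset V).powerset, if S = ∅ then (-(Fintype.card V : ℤ)) else 0 := by
    rw [sum_conn, TT, ← Finset.sum_add_distrib, ← Finset.sum_add_distrib]
    apply Finset.sum_congr rfl
    intro S _
    rcases S.eq_empty_or_nonempty with rfl | hne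
    · simp [PD]
    · by_cases hcon : (G.induce (S : Set V)).Connected <;> simp [PD, hne, hne.ne_empty, hcon]
  rw [sum_full, Finset.sum_ite_eq'] at hs
  simp only [Finset.card_univ, Finset.empty_mem_powerset, if_true] at hs key
  linarith

lemma upper {V : Type*} [Fintype V] {G : SimpleGraph V} (h : P4f G) (hn : 1 ≤ Fintype.card V) :
    ∑ S ∈ connSets G, (2 * (S.card : ℤ) - (Fintype.card V + 1)) ≤ 0 := by
  have key := Q_lem (str_PC h) Finset.univ (Finset.card_pos.1 (by rw [Finset.card_univ]; omega))
  have hs : ∑ S ∈ connSets G, (2 * (S.card : ℤ) - (Fintype.card V + 1)) =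
      TT (PC G) Finset.univ (Fintype.card V + 1)
      + ∑ S ∈ (Finset.univ : Finset V).powerset,
          if S.card = 1 then (1 - (Fintype.card V : ℤ)) else 0 := by
    rw [sum_conn, TT, ← Finset.sum_add_distrib]
    apply Finset.sum_congr rfl
    intro S _
    rcases Nat.lt_or_ge S.card 2 with hl | hl
    · have hPC : ¬ PC G S := fun hp => by have := hp.1; omega
      by_cases h1 : S.card = 1
      · have : S.Nonempty := Finset.card_pos.1 (by omega)
        simp only [this, conn_small h1, hPC, h1]; simp; ring
      · have : S = ∅ := Finset.card_eq_zero.1 (by omega)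
        subst this
        simp [hPC]
    · have : S.Nonempty := Finset.card_pos.1 (by omega)
      have h1 : S.card ≠ 1 := by omega
      simp [PC, hl, this, h1]
  have hcnt : (∑ S ∈ (Finset.univ : Finset V).powerset,
      if S.card = 1 then (1 - (Fintype.card V : ℤ)) else 0)
      = Fintype.card V * (1 - (Fintype.card V : ℤ)) := by
    rw [← Finset.sum_filter, Finset.sum_const, ← Finset.powersetCard_eq_filter,
      Finset.card_powersetCard]
    simp
  rw [hs, hcnt]
  simp only [Finset.card_univ] at key
  nlinarith [sq_nonneg ((Fintype.card V : ℤ) - 1)]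

end helpers

theorem stmt_18 {V₁ V₂ : Type*} [Fintype V₁] [Fintype V₂]
    (G₁ : SimpleGraph V₁) (G₂ : SimpleGraph V₂)
    (h1 : 2 ≤ Fintype.card V₁) (h2 : Fintype.card V₂ < Fintype.card V₁)
    (hc1 : IsCograph G₁) (hconn1 : G₁.Connected) (hc2 : IsCograph G₂) :
    globalMean G₂ < globalMean G₁ := by
  have hl := lower (P4f_of hc1) h1 hconn1
  have hpos : 0 < (connSets G₁).card := by
    rw [Finset.card_pos, Finset.nonempty_iff_ne_empty]
    intro he
    simp [he] at hl
  have hl' : (Fintype.card V₁ : ℝ) / 2 < globalMean G₁ := by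
    unfold globalMean
    rw [lt_div_iff₀ (by exact_mod_cast hpos)]
    have : (0:ℝ) < ∑ S ∈ connSets G₁, (2 * (S.card : ℝ) - Fintype.card V₁) := by exact_mod_cast hl
    rw [Finset.sum_sub_distrib, ← Finset.mul_sum, Finset.sum_const, nsmul_eq_mul] at this
    linarith
  refine lt_of_le_of_lt ?_ hl'
  unfold globalMean
  rcases Nat.eq_zero_or_pos (connSets G₂).card with h0 | h0
  · rw [h0]; simp; positivity
  rw [div_le_iff₀ (by exact_mod_cast h0)]
  have hn : 1 ≤ Fintype.card V₂ := by
    obtain ⟨S, hS⟩ := Finset.card_pos.1 h0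
    obtain ⟨x, -⟩ := ((mem_connSets _ _).1 hS).1
    exact Fintype.card_pos_iff.2 ⟨x⟩
  have hu := upper (P4f_of hc2) hn
  have : ∑ S ∈ connSets G₂, (2 * (S.card : ℝ) - (Fintype.card V₂ + 1)) ≤ 0 := by exact_mod_cast hu
  rw [Finset.sum_sub_distrib, ← Finset.mul_sum, Finset.sum_const, nsmul_eq_mul] at this
  have h3 : (Fintype.card V₂ : ℝ) + 1 ≤ Fintype.card V₁ := by exact_mod_cast h2
  have h4 : ((connSets G₂).card : ℝ) * (Fintype.card V₂ + 1) ≤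
      (connSets G₂).card * Fintype.card V₁ := by gcongr
  linarith
end

section
/- Let n ≥ 9 and let G be a disconnected cograph of order n. Then M_G ≤ M_{K_1 ∪ K_{1,n−2}}, where K_1 ∪ K_{1,n−2} is the disjoint union of a single vertex and the star of order n−1. -/
open SimpleGraph Finset

namespace S19

def NoP4 {V : Type*} (G : SimpleGraph V) : Prop :=
  ∀ a b c d, G.Adj a b → G.Adj b c → G.Adj c d → ¬ G.Adj a c → ¬ G.Adj b d → ¬ G.Adj a d → False

lemma noP4_of {V : Type*} (G : SimpleGraph V) (h : IsCograph G) : NoP4 G := by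
  intro a b c d hab hbc hcd hac hbd had
  apply h.false
  have h1 := hab.ne
  have h2 := hbc.ne
  have h3 := hcd.ne
  have h4 : a ≠ c := by rintro rfl; exact had hcd
  have h5 : b ≠ d := by rintro rfl; exact had hab
  have h6 : a ≠ d := by rintro rfl; exact hac hcd.symm
  refine ⟨⟨![a, b, c, d], ?_⟩, ?_⟩
  · intro i j hij
    fin_cases i <;> fin_cases j <;> simp_all
  · intro i j
    change G.Adj (![a, b, c, d] i) (![a, b, c, d] j) ↔ _
    have := hab.symm
    have := hbc.symm
    have := hcd.symm
    have : ¬ G.Adj c a := fun h => hac h.symm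
    have : ¬ G.Adj d b := fun h => hbd h.symm
    have : ¬ G.Adj d a := fun h => had h.symm
    fin_cases i <;> fin_cases j <;> simp_all [SimpleGraph.pathGraph_adj]

lemma NoP4.compl {V : Type*} {G : SimpleGraph V} (h : NoP4 G) : NoP4 Gᶜ := by
  intro a b c d hab hbc hcd hac hbd had
  have h4 : a ≠ c := by rintro rfl; exact had hcd
  have h5 : b ≠ d := by rintro rfl; exact had hab
  have h6 : a ≠ d := by rintro rfl; exact hac hcd.symm
  rw [SimpleGraph.compl_adj] at *
  have e1 : G.Adj a c := by tauto
  have e2 : G.Adj b d := by tauto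
  have e3 : G.Adj a d := by tauto
  exact h c a d b e1.symm e3 e2.symm (fun h => hcd.2 h) (fun h => hab.2 h) (fun h => hbc.2 h.symm)

def Split {V : Type*} (G : SimpleGraph V) (X A B : Finset V) : Prop :=
  A.Nonempty ∧ B.Nonempty ∧ Disjoint A B ∧ (∀ x, x ∈ X ↔ x ∈ A ∨ x ∈ B) ∧
    ∀ a ∈ A, ∀ b ∈ B, ¬ G.Adj a b

open Classical in
lemma split_step {V : Type*} {G : SimpleGraph V} (h : NoP4 G) (X A B : Finset V) (v : V)
    (hv : v ∉ X) (hs : Split G X A B) :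
    (∃ A B, Split G (insert v X) A B) ∨ ∃ A B, Split Gᶜ (insert v X) A B := by
  obtain ⟨hA, hB, hd, hX, hn⟩ := hs
  have hvA : v ∉ A := fun h => hv ((hX v).2 (Or.inl h))
  have hvB : v ∉ B := fun h => hv ((hX v).2 (Or.inr h))
  rw [Finset.disjoint_left] at hd
  by_cases h1 : ∀ a ∈ A, ¬ G.Adj v a
  · left
    refine ⟨A, insert v B, hA, by simp, ?_, ?_, ?_⟩
    · rw [Finset.disjoint_left]; grind
    · grind
    · intro a ha b hb
      rcases Finset.mem_insert.1 hb with rfl | hb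
      · exact fun h => h1 a ha h.symm
      · exact hn a ha b hb
  by_cases h2 : ∀ a ∈ B, ¬ G.Adj v a
  · left
    refine ⟨B, insert v A, hB, by simp, ?_, ?_, ?_⟩
    · rw [Finset.disjoint_left]; grind
    · grind
    · intro a ha b hb
      rcases Finset.mem_insert.1 hb with rfl | hb
      · exact fun h => h2 a ha h.symm
      · exact fun h => hn b hb a ha h.symm
  push Not at h1 h2
  obtain ⟨a1, ha1, hva1⟩ := h1
  obtain ⟨b1, hb1, hvb1⟩ := h2
  by_cases h3 : ∃ q ∈ X, ¬ G.Adj v q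
  · left
    obtain ⟨q, hq, hvq⟩ := h3
    have key : ∀ p ∈ X, ∀ q ∈ X, G.Adj v p → ¬ G.Adj v q → ¬ G.Adj q p := by
      intro p hp q hq hvp hvq hqp
      rcases (hX p).1 hp with hpA | hpB
      · have hqA : q ∈ A := by
          rcases (hX q).1 hq with h | h
          · exact h
          · exact absurd hqp.symm (hn p hpA q h)
        exact h q p v b1 hqp hvp.symm hvb1 (fun h => hvq h.symm) (hn p hpA b1 hb1)
          (hn q hqA b1 hb1)
      · have hqB : q ∈ B := by
          rcases (hX q).1 hq with h | h
          · exact absurd hqp (hn q h p hpB)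
          · exact h
        exact h q p v a1 hqp hvp.symm hva1 (fun h => hvq h.symm) (fun h => hn a1 ha1 p hpB h.symm)
          (fun h => hn a1 ha1 q hqB h.symm)
    refine ⟨X.filter (fun q => ¬ G.Adj v q), insert v (X.filter (fun q => G.Adj v q)),
      ⟨q, by simp [hq, hvq]⟩, by simp, ?_, ?_, ?_⟩
    · rw [Finset.disjoint_left]; grind
    · intro x
      simp only [Finset.mem_insert, Finset.mem_filter]; tauto
    · intro a ha b hb
      simp only [Finset.mem_insert, Finset.mem_filter] at ha hb
      rcases hb with rfl | hb
      · exact fun h => ha.2 h.symm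
      · exact key b hb.1 a ha.1 hb.2 ha.2
  · right
    push Not at h3
    refine ⟨{v}, X, by simp, ⟨a1, (hX a1).2 (Or.inl ha1)⟩, by simpa, by simp, ?_⟩
    intro a ha b hb
    simp only [Finset.mem_singleton] at ha
    subst ha
    simp [SimpleGraph.compl_adj, h3 b hb]

open Classical in
lemma split_exists {V : Type*} {G : SimpleGraph V} (h : NoP4 G) (X : Finset V) :
    2 ≤ X.card → (∃ A B, Split G X A B) ∨ ∃ A B, Split Gᶜ X A B := by
  induction X using Finset.induction_on with
  | empty => simp
  | insert v X hv ih =>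
    intro hc
    rw [Finset.card_insert_of_notMem hv] at hc
    by_cases h2 : 2 ≤ X.card
    · rcases ih h2 with ⟨A, B, hs⟩ | ⟨A, B, hs⟩
      · exact split_step h X A B v hv hs
      · have := split_step h.compl X A B v hv hs
        rw [compl_compl] at this
        exact this.symm
    · have : X.card = 1 := by omega
      obtain ⟨w, rfl⟩ := Finset.card_eq_one.1 this
      by_cases hvw : G.Adj v w
      · right
        exact ⟨{v}, {w}, by simp, by simp, by simpa using hv, by simp, by simp [hvw]⟩
      · left
        exact ⟨{v}, {w}, by simp, by simp, by simpa using hv, by simp, by simp [hvw]⟩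

/-- A connected set cannot cross a split. -/
lemma conn_side {V : Type*} {G : SimpleGraph V} (S A B : Finset V)
    (hS : ∀ x ∈ S, x ∈ A ∨ x ∈ B) (hn : ∀ a ∈ A, ∀ b ∈ B, ¬ G.Adj a b)
    (hc : (G.induce (S : Set V)).Connected) : S ⊆ A ∨ S ⊆ B := by
  by_contra! hcon
  obtain ⟨h1, h2⟩ := hcon
  rw [Finset.not_subset] at h1 h2
  obtain ⟨b, hb, hbA⟩ := h1
  obtain ⟨a, ha, haB⟩ := h2
  have key : ∀ x y : (S : Set V), (G.induce (S : Set V)).Walk x y → (x : V) ∈ A → (y : V) ∈ A := by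
    intro x y w
    induction w with
    | nil => exact id
    | @cons u v w huv _ ih =>
      intro hu
      apply ih
      rcases hS v v.2 with h | h
      · exact h
      · exact absurd huv (hn u hu v h)
  obtain ⟨w⟩ := hc.preconnected ⟨a, ha⟩ ⟨b, hb⟩
  exact hbA (key _ _ w ((hS a ha).resolve_right haB))

lemma conn_join {V : Type*} {G : SimpleGraph V} (S A B : Finset V)
    (hS : ∀ x ∈ S, x ∈ A ∨ x ∈ B) (hd : Disjoint A B) (hn : ∀ a ∈ A, ∀ b ∈ B, ¬ Gᶜ.Adj a b)
    (a b : V) (ha : a ∈ A) (haS : a ∈ S) (hb : b ∈ B) (hbS : b ∈ S) :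
    (G.induce (S : Set V)).Connected := by
  rw [Finset.disjoint_left] at hd
  have hadj : ∀ a ∈ A, ∀ b ∈ B, G.Adj a b := by
    intro a ha b hb
    have := hn a ha b hb
    rw [SimpleGraph.compl_adj] at this
    have hne : a ≠ b := by rintro rfl; exact hd ha hb
    tauto
  have hab : (G.induce (S : Set V)).Reachable ⟨a, haS⟩ ⟨b, hbS⟩ :=
    SimpleGraph.Adj.reachable (by simpa using hadj a ha b hb)
  rw [SimpleGraph.connected_iff_exists_forall_reachable]
  refine ⟨⟨a, haS⟩, ?_⟩
  rintro ⟨x, hx⟩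
  rcases hS x hx with h | h
  · refine hab.trans (SimpleGraph.Adj.reachable ?_)
    simpa using (hadj x h b hb).symm
  · exact SimpleGraph.Adj.reachable (by simpa using hadj a ha x h)

open Classical in
noncomputable def C {V : Type*} (G : SimpleGraph V) (X : Finset V) : Finset (Finset V) :=
  X.powerset.filter (fun S => 2 ≤ S.card ∧ (G.induce (S : Set V)).Connected)

noncomputable def F {V : Type*} (G : SimpleGraph V) (X : Finset V) (t : ℝ) : ℝ :=
  ∑ S ∈ C G X, ((S.card : ℝ) - t)

lemma disj_C {V : Type*} (G : SimpleGraph V) {A B : Finset V} (hd : Disjoint A B) :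
    Disjoint (C G A) (C G B) := by
  rw [Finset.disjoint_left] at *
  intro S hA hB
  simp only [C, Finset.mem_filter, Finset.mem_powerset] at hA hB
  have : 0 < S.card := by omega
  obtain ⟨x, hx⟩ := Finset.card_pos.1 this
  exact hd (hA.1 hx) (hB.1 hx)

lemma F_split {V : Type*} {G : SimpleGraph V} {X A B : Finset V} (h : Split G X A B) (t : ℝ) :
    F G X t = F G A t + F G B t := by
  classical
  obtain ⟨hA, hB, hd, hX, hn⟩ := h
  unfold F
  rw [← Finset.sum_union (disj_C G hd)]
  congr 1
  ext S
  simp only [C, Finset.mem_filter, Finset.mem_powerset, Finset.mem_union]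
  constructor
  · rintro ⟨h1, h2, h3⟩
    rcases conn_side S A B (fun x hx => (hX x).1 (h1 hx)) hn h3 with h | h
    · exact Or.inl ⟨h, h2, h3⟩
    · exact Or.inr ⟨h, h2, h3⟩
  · rintro (⟨h1, h2⟩ | ⟨h1, h2⟩)
    · exact ⟨fun x hx => (hX x).2 (Or.inl (h1 hx)), h2⟩
    · exact ⟨fun x hx => (hX x).2 (Or.inr (h1 hx)), h2⟩

lemma sum_pow {V : Type*} (X : Finset V) (t : ℝ) :
    ∑ S ∈ X.powerset, ((S.card : ℝ) - t) = 2 ^ X.card * ((X.card : ℝ) / 2 - t) := by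
  classical
  induction X using Finset.induction_on with
  | empty => simp
  | insert v X hv ih =>
    rw [Finset.sum_powerset_insert hv, Finset.card_insert_of_notMem hv]
    have : ∑ S ∈ X.powerset, (((insert v S).card : ℝ) - t)
        = ∑ S ∈ X.powerset, (((S.card : ℝ) - t) + 1) := by
      apply Finset.sum_congr rfl
      intro S hS
      rw [Finset.card_insert_of_notMem (fun h => hv (Finset.mem_powerset.1 hS h))]
      push_cast; ring
    rw [this, Finset.sum_add_distrib, ih]
    simp [Finset.card_powerset]
    ring

/-- contribution of crossing sets -/
noncomputable def Bo (a b : ℕ) (t : ℝ) : ℝ :=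
  (a * 2 ^ a * (2 ^ b - 1) + b * 2 ^ b * (2 ^ a - 1)) / 2 - t * ((2 ^ a - 1) * (2 ^ b - 1))

lemma F_join {V : Type*} {G : SimpleGraph V} {X A B : Finset V} (h : Split Gᶜ X A B) (t : ℝ) :
    F G X t = F G A t + F G B t + Bo A.card B.card t := by
  classical
  obtain ⟨hA, hB, hd, hX, hn⟩ := h
  have hXe : X = A ∪ B := by ext x; simp [hX x]
  have hXc : X.card = A.card + B.card := by rw [hXe, Finset.card_union_of_disjoint hd]
  set D := X.powerset \ (A.powerset ∪ B.powerset) with hD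
  have h1 : C G X = (C G A ∪ C G B) ∪ D := by
    ext S
    simp only [C, hD, Finset.mem_filter, Finset.mem_powerset, Finset.mem_union, Finset.mem_sdiff]
    constructor
    · tauto
    · rintro ((⟨h1, h2⟩ | ⟨h1, h2⟩) | ⟨h1, h2⟩)
      · exact ⟨fun x hx => (hX x).2 (Or.inl (h1 hx)), h2⟩
      · exact ⟨fun x hx => (hX x).2 (Or.inr (h1 hx)), h2⟩
      · push Not at h2
        obtain ⟨h3, h4⟩ := h2
        rw [Finset.not_subset] at h3 h4
        obtain ⟨b, hb, hbA⟩ := h3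
        obtain ⟨a, ha, haB⟩ := h4
        have hb' := ((hX b).1 (h1 hb)).resolve_left hbA
        have ha' := ((hX a).1 (h1 ha)).resolve_right haB
        refine ⟨h1, ?_, conn_join S A B (fun x hx => (hX x).1 (h1 hx)) hd hn a b ha' ha hb' hb⟩
        exact Finset.one_lt_card.2 ⟨a, ha, b, hb, by rintro rfl; exact hbA ha'⟩
  have h2 : Disjoint (C G A ∪ C G B) D := by
    rw [Finset.disjoint_left]
    intro S hS hSD
    simp only [C, hD, Finset.mem_filter, Finset.mem_powerset, Finset.mem_union,
      Finset.mem_sdiff] at hS hSD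
    tauto
  have h3 : ∑ S ∈ D, ((S.card : ℝ) - t) = Bo A.card B.card t := by
    have hsub : A.powerset ∪ B.powerset ⊆ X.powerset := by
      intro S hS
      simp only [Finset.mem_powerset, Finset.mem_union] at hS ⊢
      rw [hXe]
      rcases hS with h | h
      · exact h.trans Finset.subset_union_left
      · exact h.trans Finset.subset_union_right
    have e1 := Finset.sum_sdiff hsub (f := fun S => ((S.card : ℝ) - t))
    have e2 := Finset.sum_union_inter (s₁ := A.powerset) (s₂ := B.powerset)
      (f := fun S => ((S.card : ℝ) - t))
    have e3 : A.powerset ∩ B.powerset = {∅} := by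
      ext S
      rw [Finset.mem_inter, Finset.mem_powerset, Finset.mem_powerset, ← Finset.subset_inter_iff,
        Finset.disjoint_iff_inter_eq_empty.1 hd, Finset.subset_empty, Finset.mem_singleton]
    rw [e3] at e2
    simp only [sum_pow, Finset.sum_singleton, Finset.card_empty, hXc] at e1 e2
    unfold Bo
    push_cast at *
    rw [pow_add] at e1
    rw [← hD] at e1
    linear_combination e1 - e2
  unfold F
  rw [h1, Finset.sum_union h2, Finset.sum_union (disj_C G hd), h3]

lemma F_small {V : Type*} (G : SimpleGraph V) {X : Finset V} (h : X.card ≤ 1) (t : ℝ) :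
    F G X t = 0 := by
  classical
  unfold F
  rw [Finset.sum_eq_zero]
  intro S hS
  simp only [C, Finset.mem_filter, Finset.mem_powerset] at hS
  have := Finset.card_le_card hS.1
  omega

lemma mean_sum {V : Type*} [Fintype V] (G : SimpleGraph V) (t : ℝ) :
    ∑ S ∈ connSets G, ((S.card : ℝ) - t) = Fintype.card V * (1 - t) + F G Finset.univ t := by
  classical
  have h1 : connSets G = (Finset.univ.map ⟨fun v : V => ({v} : Finset V), Finset.singleton_injective⟩) ∪ C G Finset.univ := by
    ext S
    simp only [connSets, Set.Finite.mem_toFinset, Set.mem_ofPred_eq, Finset.mem_union,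
      Finset.mem_map, C, Finset.mem_filter, Finset.mem_powerset, Finset.subset_univ, true_and,
      Function.Embedding.coeFn_mk, Finset.mem_univ]
    constructor
    · rintro ⟨h1, h2⟩
      by_cases h : 2 ≤ S.card
      · exact Or.inr ⟨h, h2⟩
      · left
        have := h1.card_pos
        obtain ⟨v, hv⟩ := Finset.card_eq_one.1 (show S.card = 1 by omega)
        exact ⟨v, hv.symm⟩
    · rintro (⟨v, rfl⟩ | ⟨h1, h2⟩)
      · refine ⟨by simp, ?_⟩
        rw [SimpleGraph.connected_iff_exists_forall_reachable]
        refine ⟨⟨v, by simp⟩, ?_⟩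
        rintro ⟨x, hx⟩
        have : x = v := by simpa using hx
        subst this
        exact SimpleGraph.Reachable.refl _
      · exact ⟨Finset.card_pos.1 (by omega), h2⟩
  rw [h1, Finset.sum_union]
  · simp [F]
    ring
  · rw [Finset.disjoint_left]
    intro S hS hS2
    simp only [Finset.mem_map, C, Finset.mem_filter, Function.Embedding.coeFn_mk] at hS hS2
    obtain ⟨v, _, rfl⟩ := hS
    simp at hS2

lemma mean_le {V : Type*} [Fintype V] [Nonempty V] (G : SimpleGraph V) (t : ℝ) :
    (globalMean G - t) * ((connSets G).card : ℝ) = Fintype.card V * (1 - t) + F G Finset.univ t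
     ∧ 0 < ((connSets G).card : ℝ) := by
  classical
  have hpos : 0 < ((connSets G).card : ℝ) := by
    rw [Nat.cast_pos, Finset.card_pos]
    obtain ⟨v⟩ := ‹Nonempty V›
    refine ⟨{v}, ?_⟩
    simp only [connSets, Set.Finite.mem_toFinset, Set.mem_ofPred_eq]
    refine ⟨by simp, ?_⟩
    rw [SimpleGraph.connected_iff_exists_forall_reachable]
    refine ⟨⟨v, by simp⟩, ?_⟩
    rintro ⟨x, hx⟩
    have : x = v := by simpa using hx
    subst this
    exact SimpleGraph.Reachable.refl _
  refine ⟨?_, hpos⟩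
  rw [← mean_sum, Finset.sum_sub_distrib]
  unfold globalMean
  simp only [Finset.sum_const, nsmul_eq_mul]
  field_simp

lemma Split.card {V : Type*} {G : SimpleGraph V} {X A B : Finset V} (h : Split G X A B) :
    X.card = A.card + B.card ∧ 1 ≤ A.card ∧ 1 ≤ B.card := by
  classical
  obtain ⟨hA, hB, hd, hX, hn⟩ := h
  have hXe : X = A ∪ B := by ext x; simp [hX x]
  refine ⟨by rw [hXe, Finset.card_union_of_disjoint hd], hA.card_pos, hB.card_pos⟩

lemma pow_ge1 (a : ℕ) : (a : ℝ) ≤ 2 ^ a - 1 := by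
  have : a + 1 ≤ 2 ^ a := Nat.lt_two_pow_self
  have : ((a + 1 : ℕ) : ℝ) ≤ ((2 ^ a : ℕ) : ℝ) := by exact_mod_cast this
  push_cast at this
  linarith

/-- `c a ≤ d (2^a - 1)` propagates from `k`. -/
lemma pow_ratio (k c d : ℕ) (hk : c * k + d ≤ d * 2 ^ k) (hc : c ≤ d * 2 ^ k) (a : ℕ)
    (ha : k ≤ a) : (c : ℝ) * a ≤ d * (2 ^ a - 1) := by
  have : c * a + d ≤ d * 2 ^ a ∧ c ≤ d * 2 ^ a := by
    induction a, ha using Nat.le_induction with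
    | base => exact ⟨hk, hc⟩
    | succ n hn ih =>
      rw [pow_succ]
      constructor <;> nlinarith [ih.1, ih.2]
  have h : ((c * a + d : ℕ) : ℝ) ≤ ((d * 2 ^ a : ℕ) : ℝ) := by exact_mod_cast this.1
  push_cast at h
  linarith

lemma Bo_le1 (a b : ℕ) (t : ℝ) (ht : ((a + b : ℕ) : ℝ) + 2 ≤ 2 * t) : Bo a b t ≤ 0 := by
  have h1 := pow_ge1 a
  have h2 := pow_ge1 b
  unfold Bo
  have ha : (0 : ℝ) ≤ a := by positivity
  have hb : (0 : ℝ) ≤ b := by positivity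
  push_cast at ht
  generalize (2 : ℝ) ^ a = p at *
  generalize (2 : ℝ) ^ b = q at *
  have : 0 ≤ (p - 1) * (q - 1) := mul_nonneg (by linarith) (by linarith)
  nlinarith [mul_nonneg this (sub_nonneg.2 ht), mul_nonneg (sub_nonneg.2 h1) (hb.trans h2),
    mul_nonneg (sub_nonneg.2 h2) (ha.trans h1)]

lemma L1 {V : Type*} {G : SimpleGraph V} (h : NoP4 G) (t : ℝ) (k : ℕ) :
    ∀ X : Finset V, X.card ≤ k → (X.card : ℝ) + 2 ≤ 2 * t → F G X t ≤ 0 := by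
  induction k with
  | zero => intro X hX _; rw [F_small G (by omega)]
  | succ k ih =>
    intro X hX ht
    by_cases h2 : 2 ≤ X.card
    · rcases split_exists h X h2 with ⟨A, B, hs⟩ | ⟨A, B, hs⟩
      · obtain ⟨hc, hA, hB⟩ := hs.card
        rw [F_split hs]
        rw [hc] at ht
        push_cast at ht
        have := ih A (by omega) (by linarith [(Nat.cast_nonneg B.card : (0:ℝ) ≤ _)])
        have := ih B (by omega) (by linarith [(Nat.cast_nonneg A.card : (0:ℝ) ≤ _)])
        linarith
      · obtain ⟨hc, hA, hB⟩ := hs.card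
        rw [F_join hs]
        rw [hc] at ht
        have := Bo_le1 A.card B.card t ht
        push_cast at ht
        have := ih A (by omega) (by linarith [(Nat.cast_nonneg B.card : (0:ℝ) ≤ _)])
        have := ih B (by omega) (by linarith [(Nat.cast_nonneg A.card : (0:ℝ) ≤ _)])
        linarith
    · rw [F_small G (by omega)]

lemma Bo_comm (a b : ℕ) (t : ℝ) : Bo a b t = Bo b a t := by unfold Bo; ring

/-- The improved bound at larger order. -/
lemma Bo_le2 (a b : ℕ) (t : ℝ) (ha : 1 ≤ a) (hb : 1 ≤ b) (hab : 7 ≤ a + b)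
    (ht : ((a + b : ℕ) : ℝ) + 3 / 2 ≤ 2 * t) : Bo a b t ≤ 0 := by
  wlog hle : a ≤ b generalizing a b
  · rw [Bo_comm]
    exact this b a hb ha (by omega) (by rwa [add_comm b a]) (by omega)
  have h1 := pow_ge1 a
  have h2 := pow_ratio 4 15 4 (by norm_num) (by norm_num) b (by omega)
  unfold Bo
  have ha : (1 : ℝ) ≤ a := by exact_mod_cast ha
  have hb : (1 : ℝ) ≤ b := by exact_mod_cast hb
  push_cast at ht h2
  generalize (2 : ℝ) ^ a = p at *
  generalize (2 : ℝ) ^ b = q at *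
  have : 0 ≤ (p - 1) * (q - 1) := mul_nonneg (by linarith) (by linarith)
  have hp : 0 ≤ p - 1 := by linarith
  have hq : 0 ≤ q - 1 := by linarith
  nlinarith [mul_nonneg this (sub_nonneg.2 ht), mul_nonneg (sub_nonneg.2 h1) hq,
    mul_nonneg (sub_nonneg.2 h2) hp]

lemma L2 {V : Type*} {G : SimpleGraph V} (h : NoP4 G) (t : ℝ) (m : ℕ) (hm : 7 ≤ m)
    (ht : (m : ℝ) + 3 / 2 ≤ 2 * t) (X : Finset V) (hX : X.card ≤ m) : F G X t ≤ 0 := by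
  rcases hX.lt_or_eq with hlt | heq
  · apply L1 h t _ X le_rfl
    have : ((X.card + 1 : ℕ) : ℝ) ≤ m := by exact_mod_cast hlt
    push_cast at this
    linarith
  · have key : ∀ A : Finset V, A.card + 1 ≤ m → F G A t ≤ 0 := by
      intro A hA
      apply L1 h t _ A le_rfl
      have : ((A.card + 1 : ℕ) : ℝ) ≤ m := by exact_mod_cast hA
      push_cast at this
      linarith
    rcases split_exists h X (by omega) with ⟨A, B, hs⟩ | ⟨A, B, hs⟩
    · obtain ⟨hc, hA, hB⟩ := hs.card
      rw [F_split hs]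
      linarith [key A (by omega), key B (by omega)]
    · obtain ⟨hc, hA, hB⟩ := hs.card
      rw [F_join hs]
      have := Bo_le2 A.card B.card t hA hB (by omega) (by rw [← hc, heq]; exact ht)
      linarith [key A (by omega), key B (by omega)]

lemma natq1 (m : ℕ) (hm : 7 ≤ m) : (m + 1) * (2 * m) ≤ 2 ^ m + (m + 1) := by
  induction m, hm using Nat.le_induction with
  | base => norm_num
  | succ n hn ih =>
    rw [pow_succ]
    nlinarith

lemma natq2 (m : ℕ) (hm : 8 ≤ m) : 11 * m * (m + 1) ≤ 3 * 2 ^ m + 3 * (m + 1) := by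
  induction m, hm using Nat.le_induction with
  | base => norm_num
  | succ n hn ih =>
    rw [pow_succ]
    nlinarith

lemma T_eq (m : ℕ) (T : ℝ) (hT : ((m : ℝ) + 2) * (1 - T) + Bo 1 m T = 0) :
    ((m : ℝ) + 1 + 2 ^ m) * (2 * T - 2) = m * 2 ^ m := by
  unfold Bo at hT
  push_cast at hT
  linear_combination -2 * hT

lemma T_lower1 (m : ℕ) (hm : 7 ≤ m) (T : ℝ)
    (hT : ((m : ℝ) + 2) * (1 - T) + Bo 1 m T = 0) : (m : ℝ) + 3 / 2 ≤ 2 * T := by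
  have h := T_eq m T hT
  have hq : (((m + 1) * (2 * m) : ℕ) : ℝ) ≤ ((2 ^ m + (m + 1) : ℕ) : ℝ) := by
    exact_mod_cast natq1 m hm
  push_cast at hq
  have hpos : (0 : ℝ) < (m : ℝ) + 1 + 2 ^ m := by positivity
  have : 0 ≤ ((m : ℝ) + 1 + 2 ^ m) * (2 * T - (m + 3 / 2)) := by nlinarith
  linarith [nonneg_of_mul_nonneg_right this hpos]

lemma T_lower2 (m : ℕ) (hm : 8 ≤ m) (T : ℝ)
    (hT : ((m : ℝ) + 2) * (1 - T) + Bo 1 m T = 0) : (m : ℝ) + 1 + 8 / 11 ≤ 2 * T := by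
  have h := T_eq m T hT
  have hq : ((11 * m * (m + 1) : ℕ) : ℝ) ≤ ((3 * 2 ^ m + 3 * (m + 1) : ℕ) : ℝ) := by
    exact_mod_cast natq2 m hm
  push_cast at hq
  have hpos : (0 : ℝ) < (m : ℝ) + 1 + 2 ^ m := by positivity
  have : 0 ≤ ((m : ℝ) + 1 + 2 ^ m) * (2 * T - (m + 1 + 8 / 11)) := by nlinarith
  linarith [nonneg_of_mul_nonneg_right this hpos]

lemma main_join (m : ℕ) (hm : 7 ≤ m) (T : ℝ)
    (hT : ((m : ℝ) + 2) * (1 - T) + Bo 1 m T = 0) (a b : ℕ) (ha : 1 ≤ a) (hb : 1 ≤ b)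
    (hab : a + b = m + 1) : ((m : ℝ) + 2) * (1 - T) + Bo a b T ≤ 0 := by
  wlog hle : a ≤ b generalizing a b
  · rw [Bo_comm]
    exact this b a hb ha (by omega) (by omega)
  rcases ha.eq_or_lt with rfl | ha
  · obtain rfl : b = m := by omega
    exact hT.le
  rcases hm.eq_or_lt with rfl | hm
  · have h := T_eq 7 T hT
    norm_num at h
    have hTv : T = 73 / 17 := by linarith
    subst hTv
    obtain rfl : b = 8 - a := by omega
    have : a ≤ 4 := by omega
    interval_cases a <;> norm_num [Bo]
  · have hl := T_lower2 m hm T hT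
    have hneg : ((m : ℝ) + 2) * (1 - T) ≤ 0 := by
      have : (0 : ℝ) ≤ m := by positivity
      have : (8 : ℝ) ≤ m := by exact_mod_cast hm
      apply mul_nonpos_of_nonneg_of_nonpos <;> linarith
    have hmab : (a : ℝ) + b = m + 1 := by exact_mod_cast hab
    have hBo : Bo a b T ≤ 0 := by
      have hx : ∃ x y : ℝ, (a : ℝ) ≤ x * (2 ^ a - 1) ∧ (b : ℝ) ≤ y * (2 ^ b - 1) ∧
          x + y ≤ 8 / 11 := by
        rcases (show 2 ≤ a from ha).eq_or_lt with rfl | ha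
        · refine ⟨2 / 3, 7 / 127, by norm_num, ?_, by norm_num⟩
          have := pow_ratio 7 127 7 (by norm_num) (by norm_num) b (by omega)
          push_cast at this
          linarith
        · refine ⟨3 / 7, 5 / 31, ?_, ?_, by norm_num⟩
          · have := pow_ratio 3 7 3 (by norm_num) (by norm_num) a (by omega)
            push_cast at this
            linarith
          · have := pow_ratio 5 31 5 (by norm_num) (by norm_num) b (by omega)
            push_cast at this
            linarith
      obtain ⟨x, y, h1, h2, hxy⟩ := hx
      have hp : (0 : ℝ) ≤ 2 ^ a - 1 := le_trans (by positivity) (pow_ge1 a)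
      have hq : (0 : ℝ) ≤ 2 ^ b - 1 := le_trans (by positivity) (pow_ge1 b)
      unfold Bo
      generalize (2 : ℝ) ^ a = p at *
      generalize (2 : ℝ) ^ b = q at *
      have hpq := mul_nonneg hp hq
      have e1 := mul_nonneg (sub_nonneg.2 h1) hq
      have e2 := mul_nonneg (sub_nonneg.2 h2) hp
      have e3 := mul_nonneg hpq (sub_nonneg.2 hxy)
      have e4 : 0 ≤ ((p - 1) * (q - 1)) * (2 * T - (a + b + 8 / 11)) :=
        mul_nonneg hpq (by linarith)
      nlinarith
    linarith

lemma conn_of_split {V : Type*} [Fintype V] {G : SimpleGraph V} {A B : Finset V}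
    (h : Split Gᶜ Finset.univ A B) : G.Connected := by
  obtain ⟨⟨a, ha⟩, ⟨b, hb⟩, hd, hX, hn⟩ := h
  have := conn_join (G := G) Finset.univ A B (fun x _ => (hX x).1 (Finset.mem_univ x)) hd hn
    a b ha (Finset.mem_univ a) hb (Finset.mem_univ b)
  rw [Finset.coe_univ] at this
  exact (SimpleGraph.induceUnivIso G).connected_iff.1 this

lemma F_indep {V : Type*} {G : SimpleGraph V} {X : Finset V}
    (h : ∀ x ∈ X, ∀ y ∈ X, ¬ G.Adj x y) (t : ℝ) : F G X t = 0 := by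
  classical
  unfold F
  rw [Finset.sum_eq_zero]
  intro S hS
  exfalso
  simp only [C, Finset.mem_filter, Finset.mem_powerset] at hS
  obtain ⟨x, hx, y, hy, hne⟩ := Finset.one_lt_card.1 hS.2.1
  rcases conn_side S {x} (S.erase x) (by grind)
    (fun a ha b hb => h a (hS.1 (by grind)) b (hS.1 (by grind))) hS.2.2 with h | h
  · have := h hy; grind
  · have := h hx; grind

lemma target (m : ℕ) (t : ℝ) :
    F ((⊥ : SimpleGraph (Fin 1)) ⊕g completeBipartiteGraph (Fin 1) (Fin (m + 1)))
      Finset.univ t = Bo 1 (m + 1) t := by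
  classical
  set G := ((⊥ : SimpleGraph (Fin 1)) ⊕g completeBipartiteGraph (Fin 1) (Fin (m + 1))) with hG
  let L : Finset (Fin 1 ⊕ (Fin 1 ⊕ Fin (m + 1))) :=
    Finset.univ.image (fun i : Fin (m + 1) => Sum.inr (Sum.inr i))
  have hL : L.card = m + 1 := by
    rw [Finset.card_image_of_injective _ (fun i j h => by simpa using h)]
    simp
  have s1 : Split G Finset.univ {Sum.inl 0} (insert (Sum.inr (Sum.inl 0)) L) := by
    refine ⟨by simp, by simp, by simp [L], ?_, ?_⟩
    · rintro (x | x | x)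
      · simp [Subsingleton.elim x 0]
      · simp [Subsingleton.elim x 0]
      · simp [L]
    · rintro a ha b hb
      simp only [Finset.mem_singleton] at ha
      subst ha
      simp only [Finset.mem_insert, L, Finset.mem_image] at hb
      rcases hb with rfl | ⟨i, _, rfl⟩ <;> simp [hG]
  have s2 : Split Gᶜ (insert (Sum.inr (Sum.inl 0)) L) {Sum.inr (Sum.inl 0)} L := by
    refine ⟨by simp, Finset.card_pos.1 (by omega), by simp [L], by simp, ?_⟩
    rintro a ha b hb
    simp only [Finset.mem_singleton] at ha
    subst ha
    simp only [L, Finset.mem_image] at hb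
    rcases hb with ⟨i, _, rfl⟩
    simp [hG]
  rw [F_split s1, F_join s2, F_small G (by simp), F_small G (by simp), F_indep, hL]
  · simp
  · intro x hx y hy
    simp only [L, Finset.mem_image] at hx hy
    rcases hx with ⟨i, _, rfl⟩
    rcases hy with ⟨j, _, rfl⟩
    simp [hG]

end S19

theorem stmt_19 {V : Type*} [Fintype V] (G : SimpleGraph V) (n : ℕ) (hn : 9 ≤ n)
    (hcard : Fintype.card V = n) (hcog : IsCograph G) (hdisconn : ¬ G.Connected) :
    globalMean G ≤
      globalMean ((⊥ : SimpleGraph (Fin 1)) ⊕g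
        completeBipartiteGraph (Fin 1) (Fin (n - 2))) := by
  obtain ⟨m, rfl⟩ : ∃ m, n = m + 1 + 2 := ⟨n - 3, by omega⟩
  change globalMean G ≤
      globalMean ((⊥ : SimpleGraph (Fin 1)) ⊕g
        completeBipartiteGraph (Fin 1) (Fin (m + 1)))
  have hT := (S19.mean_le ((⊥ : SimpleGraph (Fin 1)) ⊕g
        completeBipartiteGraph (Fin 1) (Fin (m + 1))) (globalMean ((⊥ : SimpleGraph (Fin 1)) ⊕g
        completeBipartiteGraph (Fin 1) (Fin (m + 1))))).1
  rw [S19.target] at hT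
  generalize globalMean ((⊥ : SimpleGraph (Fin 1)) ⊕g
        completeBipartiteGraph (Fin 1) (Fin (m + 1))) = T at *
  have hm : 7 ≤ m + 1 := by omega
  generalize m + 1 = k at *
  have hT : ((k : ℝ) + 2) * (1 - T) + S19.Bo 1 k T = 0 := by
    rw [sub_self, zero_mul] at hT
    rw [hT]
    simp only [Fintype.card_sum, Fintype.card_fin]
    push_cast
    ring
  have hP := S19.noP4_of G hcog
  have hlow := S19.T_lower1 k hm T hT
  have hk7 : (7 : ℝ) ≤ k := by exact_mod_cast hm
  have hneg : ((k : ℝ) + 2) * (1 - T) ≤ 0 := by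
    apply mul_nonpos_of_nonneg_of_nonpos <;> linarith
  have : Nonempty V := Fintype.card_pos_iff.1 (by omega)
  obtain ⟨h1, h2⟩ := S19.mean_le G T
  have hL := S19.L2 hP T k hm hlow
  have big : ∀ X : Finset V, X.card = k + 1 → ((k : ℝ) + 2) * (1 - T) + S19.F G X T ≤ 0 := by
    intro X hX
    rcases S19.split_exists hP X (by omega) with ⟨A, B, hs⟩ | ⟨A, B, hs⟩
    · obtain ⟨hc, hA, hB⟩ := hs.card
      rw [S19.F_split hs]
      linarith [hL A (by omega), hL B (by omega)]
    · obtain ⟨hc, hA, hB⟩ := hs.card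
      rw [S19.F_join hs]
      have := S19.main_join k hm T hT A.card B.card hA hB (by omega)
      linarith [hL A (by omega), hL B (by omega)]
  have fin : ((k : ℝ) + 2) * (1 - T) + S19.F G Finset.univ T ≤ 0 := by
    have hu : (Finset.univ : Finset V).card = k + 2 := by rw [Finset.card_univ, hcard]
    rcases S19.split_exists hP Finset.univ (by omega) with ⟨A, B, hs⟩ | ⟨A, B, hs⟩
    · obtain ⟨hc, hA, hB⟩ := hs.card
      rw [S19.F_split hs]
      by_cases hA1 : A.card = 1
      · rw [S19.F_small G hA1.le, zero_add]
        exact big B (by omega)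
      by_cases hB1 : B.card = 1
      · rw [S19.F_small G hB1.le, add_zero]
        exact big A (by omega)
      linarith [hL A (by omega), hL B (by omega)]
    · exact absurd (S19.conn_of_split hs) hdisconn
  rw [hcard] at h1
  push_cast at h1
  by_contra hcon
  push Not at hcon
  have := mul_pos (sub_pos.2 hcon) h2
  linarith
end
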